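/- Let α > 0 and let μ₀ be a probability measure on ℝ^d. If there exists a solution (μ_t)_{t∈[0,T]} to the martingale problem (MP)^α_{μ₀}, then α is a positive integer n, and there exist points x₁, …, x_n ∈ ℝ^d such that μ₀ = (1/n) ∑_{i=1}^n δ_{x_i}. -/

import Mathlib

open MeasureTheory ProbabilityTheory Filter Set
open scoped ENNReal NNReal

noncomputable section

/-- Pairing `⟨μ, f⟩ = ∫ f dμ`. -/
def pairing {d : ℕ} (μ : ProbabilityMeasure (EuclideanSpace ℝ (Fin d)))
    (f : EuclideanSpace ℝ (Fin d) → ℝ) : ℝ :=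
  ∫ x, f x ∂(μ : Measure (EuclideanSpace ℝ (Fin d)))

/-- The Laplacian: sum of second partial derivatives. -/
def laplacian {d : ℕ} (φ : EuclideanSpace ℝ (Fin d) → ℝ) (x : EuclideanSpace ℝ (Fin d)) : ℝ :=
  ∑ i : Fin d,
    fderiv ℝ (fun y => fderiv ℝ φ y (EuclideanSpace.single i 1)) x (EuclideanSpace.single i 1)

/-- Squared norm of the gradient. -/
def gradSq {d : ℕ} (φ : EuclideanSpace ℝ (Fin d) → ℝ) (x : EuclideanSpace ℝ (Fin d)) : ℝ :=
  ‖gradient φ x‖ ^ 2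

/-- A real-valued process is a martingale on the time interval `[0, T]`
with respect to the filtration `ℱ` and measure `P`. -/
def MartingaleOn {Ω : Type*} {mΩ : MeasurableSpace Ω} (X : ℝ → Ω → ℝ)
    (ℱ : Filtration ℝ mΩ) (P : Measure Ω) (T : ℝ) : Prop :=
  (∀ t, 0 ≤ t → t ≤ T → StronglyMeasurable[ℱ t] (X t)) ∧
  ∀ s t, 0 ≤ s → s ≤ t → t ≤ T → P[X t | ℱ s] =ᵐ[P] X s

/-- Solution of the martingale problem `(MP)^α_{μ₀}` on `[0,T]`: an a.s. continuous,
adapted probability-measure-valued process `μ` with `μ_0 = μ₀` such that for every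
compactly supported smooth `φ`, the process
`M_t(φ) = ⟨μ_t, φ⟩ − ⟨μ₀, φ⟩ − (α/2)∫₀ᵗ ⟨μ_s, Δφ⟩ ds` is a martingale with
quadratic variation `∫₀ᵗ ⟨μ_s, ‖∇φ‖²⟩ ds`. -/
structure IsMPSolution (d : ℕ) (T α : ℝ) {Ω : Type*} [mΩ : MeasurableSpace Ω]
    (ℱ : Filtration ℝ mΩ) (P : Measure Ω)
    (μ0 : ProbabilityMeasure (EuclideanSpace ℝ (Fin d)))
    (μ : ℝ → Ω → ProbabilityMeasure (EuclideanSpace ℝ (Fin d))) : Prop where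
  init : ∀ᵐ ω ∂P, μ 0 ω = μ0
  cont : ∀ᵐ ω ∂P, ContinuousOn (fun t => μ t ω) (Set.Icc 0 T)
  mart : ∀ φ : EuclideanSpace ℝ (Fin d) → ℝ, ContDiff ℝ (⊤ : ℕ∞) φ → HasCompactSupport φ →
    MartingaleOn (fun t ω => pairing (μ t ω) φ - pairing μ0 φ
      - (α / 2) * ∫ s in (0:ℝ)..t, pairing (μ s ω) (laplacian φ)) ℱ P T
  qvar : ∀ φ : EuclideanSpace ℝ (Fin d) → ℝ, ContDiff ℝ (⊤ : ℕ∞) φ → HasCompactSupport φ →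
    MartingaleOn (fun t ω => (pairing (μ t ω) φ - pairing μ0 φ
      - (α / 2) * ∫ s in (0:ℝ)..t, pairing (μ s ω) (laplacian φ)) ^ 2
      - ∫ s in (0:ℝ)..t, pairing (μ s ω) (gradSq φ)) ℱ P T

open scoped Topology

section Calculus

variable {d : ℕ}

/-- Smooth compactly supported functions. -/
structure IsTest (φ : EuclideanSpace ℝ (Fin d) → ℝ) : Prop where
  smooth : ContDiff ℝ (⊤ : ℕ∞) φ
  compact : HasCompactSupport φ

/-- The partial derivative in the `i`-th coordinate direction. -/
def pderiv (i : Fin d) (f : EuclideanSpace ℝ (Fin d) → ℝ) (x : EuclideanSpace ℝ (Fin d)) : ℝ :=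
  fderiv ℝ f x (EuclideanSpace.single i 1)

lemma laplacian_eq_sum_pderiv (f : EuclideanSpace ℝ (Fin d) → ℝ) :
    laplacian f = fun x => ∑ i, pderiv i (pderiv i f) x := rfl

lemma gradSq_eq_sum_pderiv (f : EuclideanSpace ℝ (Fin d) → ℝ) :
    gradSq f = fun x => ∑ i, pderiv i f x ^ 2 := by
  funext x
  have h : ∀ i, gradient f x i = pderiv i f x := by
    intro i
    have := EuclideanSpace.inner_single_right (𝕜 := ℝ) i 1 (gradient f x)
    simp only [one_mul] at this
    simp only [conj_trivial] at this
    rw [← this, gradient, InnerProductSpace.toDual_symm_apply, pderiv]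
  rw [gradSq, EuclideanSpace.norm_sq_eq]
  simp [h]

lemma contDiff_pderiv {f : EuclideanSpace ℝ (Fin d) → ℝ} (hf : ContDiff ℝ (⊤ : ℕ∞) f)
    (i : Fin d) : ContDiff ℝ (⊤ : ℕ∞) (pderiv i f) :=
  (hf.fderiv_right (m := (⊤ : ℕ∞)) (by simp)).clm_apply contDiff_const

lemma pderiv_mul {f g : EuclideanSpace ℝ (Fin d) → ℝ} (hf : ContDiff ℝ (⊤ : ℕ∞) f)
    (hg : ContDiff ℝ (⊤ : ℕ∞) g) (i : Fin d) :
    pderiv i (fun x => f x * g x) = fun x => f x * pderiv i g x + pderiv i f x * g x := by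
  funext x
  have h1 := hf.differentiable (by simp) x
  have h2 := hg.differentiable (by simp) x
  simp [pderiv, fderiv_fun_mul h1 h2, mul_comm]

lemma pderiv_add {f g : EuclideanSpace ℝ (Fin d) → ℝ} (hf : ContDiff ℝ (⊤ : ℕ∞) f)
    (hg : ContDiff ℝ (⊤ : ℕ∞) g) (i : Fin d) :
    pderiv i (fun x => f x + g x) = fun x => pderiv i f x + pderiv i g x := by
  funext x
  have h1 := hf.differentiable (by simp) x
  have h2 := hg.differentiable (by simp) x
  simp [pderiv, fderiv_fun_add h1 h2]

lemma laplacian_mul {f g : EuclideanSpace ℝ (Fin d) → ℝ} (hf : ContDiff ℝ (⊤ : ℕ∞) f)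
    (hg : ContDiff ℝ (⊤ : ℕ∞) g) (x : EuclideanSpace ℝ (Fin d)) :
    laplacian (fun x => f x * g x) x
      = f x * laplacian g x + 2 * ∑ i, pderiv i f x * pderiv i g x + laplacian f x * g x := by
  simp only [laplacian_eq_sum_pderiv, Finset.mul_sum, Finset.sum_mul, ← Finset.sum_add_distrib]
  refine Finset.sum_congr rfl fun i _ => ?_
  have hf' := contDiff_pderiv hf i
  have hg' := contDiff_pderiv hg i
  rw [pderiv_mul hf hg, pderiv_add (hf.mul hg') (hf'.mul hg), pderiv_mul hf hg',
    pderiv_mul hf' hg]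
  ring

/-- The plane wave `x ↦ cos (k x_i)`. -/
def cosWave (i : Fin d) (k : ℝ) (x : EuclideanSpace ℝ (Fin d)) : ℝ := Real.cos (k * x i)

/-- The plane wave `x ↦ sin (k x_i)`. -/
def sinWave (i : Fin d) (k : ℝ) (x : EuclideanSpace ℝ (Fin d)) : ℝ := Real.sin (k * x i)

lemma contDiff_coord (i : Fin d) (k : ℝ) :
    ContDiff ℝ (⊤ : ℕ∞) (fun x : EuclideanSpace ℝ (Fin d) => k * x i) :=
  contDiff_const.mul (EuclideanSpace.proj (𝕜 := ℝ) i).contDiff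

lemma contDiff_cosWave (i : Fin d) (k : ℝ) : ContDiff ℝ (⊤ : ℕ∞) (cosWave i k) :=
  Real.contDiff_cos.comp (contDiff_coord i k)

lemma contDiff_sinWave (i : Fin d) (k : ℝ) : ContDiff ℝ (⊤ : ℕ∞) (sinWave i k) :=
  Real.contDiff_sin.comp (contDiff_coord i k)

lemma hasFDerivAt_coord (i : Fin d) (k : ℝ) (x : EuclideanSpace ℝ (Fin d)) :
    HasFDerivAt (fun x : EuclideanSpace ℝ (Fin d) => k * x i)
      (k • (EuclideanSpace.proj (𝕜 := ℝ) i : EuclideanSpace ℝ (Fin d) →L[ℝ] ℝ)) x :=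
  (EuclideanSpace.proj (𝕜 := ℝ) i).hasFDerivAt.const_mul k

lemma pderiv_cosWave (i j : Fin d) (k : ℝ) :
    pderiv j (cosWave i k) = fun x => if j = i then -k * sinWave i k x else 0 := by
  funext x
  have h := (hasFDerivAt_coord i k x).cos
  rw [pderiv, show cosWave i k = fun x => Real.cos (k * x i) from rfl, h.fderiv]
  by_cases hij : j = i
  · subst hij; simp [sinWave]; ring
  · simp [hij, Ne.symm hij]

lemma pderiv_sinWave (i j : Fin d) (k : ℝ) :
    pderiv j (sinWave i k) = fun x => if j = i then k * cosWave i k x else 0 := by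
  funext x
  have h := (hasFDerivAt_coord i k x).sin
  rw [pderiv, show sinWave i k = fun x => Real.sin (k * x i) from rfl, h.fderiv]
  by_cases hij : j = i
  · subst hij; simp [cosWave]; ring
  · simp [hij, Ne.symm hij]

lemma pderiv_const_mul {f : EuclideanSpace ℝ (Fin d) → ℝ} (hf : ContDiff ℝ (⊤ : ℕ∞) f)
    (c : ℝ) (i : Fin d) : pderiv i (fun x => c * f x) = fun x => c * pderiv i f x := by
  funext x
  have h := hf.differentiable (by simp) x
  simp [pderiv, fderiv_const_mul h]

lemma laplacian_cosWave (i : Fin d) (k : ℝ) (x : EuclideanSpace ℝ (Fin d)) :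
    laplacian (cosWave i k) x = -k ^ 2 * cosWave i k x := by
  rw [laplacian_eq_sum_pderiv]
  simp only
  rw [Finset.sum_eq_single i]
  · simp only [pderiv_cosWave, if_true]
    rw [pderiv_const_mul (contDiff_sinWave i k), pderiv_sinWave]
    simp; ring
  · intro j _ hj
    rw [pderiv_cosWave]
    simp [hj, pderiv]
  · simp

lemma laplacian_sinWave (i : Fin d) (k : ℝ) (x : EuclideanSpace ℝ (Fin d)) :
    laplacian (sinWave i k) x = -k ^ 2 * sinWave i k x := by
  rw [laplacian_eq_sum_pderiv]
  simp only
  rw [Finset.sum_eq_single i]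
  · simp only [pderiv_sinWave, if_true]
    rw [pderiv_const_mul (contDiff_cosWave i k), pderiv_cosWave]
    simp; ring
  · intro j _ hj
    rw [pderiv_sinWave]
    simp [hj, pderiv]
  · simp

/-- The Laplacian of a cosine modulation. -/
lemma laplacian_mul_cosWave {φ : EuclideanSpace ℝ (Fin d) → ℝ} (hφ : ContDiff ℝ (⊤ : ℕ∞) φ)
    (i : Fin d) (k : ℝ) (x : EuclideanSpace ℝ (Fin d)) :
    laplacian (fun x => φ x * cosWave i k x) x
      = -k ^ 2 * (φ x * cosWave i k x)
        + (laplacian φ x * cosWave i k x - 2 * k * (pderiv i φ x * sinWave i k x)) := by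
  rw [laplacian_mul hφ (contDiff_cosWave i k), laplacian_cosWave]
  simp only [pderiv_cosWave, mul_ite, mul_zero, Finset.sum_ite_eq', Finset.mem_univ, if_true]
  ring

/-- The Laplacian of a sine modulation. -/
lemma laplacian_mul_sinWave {φ : EuclideanSpace ℝ (Fin d) → ℝ} (hφ : ContDiff ℝ (⊤ : ℕ∞) φ)
    (i : Fin d) (k : ℝ) (x : EuclideanSpace ℝ (Fin d)) :
    laplacian (fun x => φ x * sinWave i k x) x
      = -k ^ 2 * (φ x * sinWave i k x)
        + (laplacian φ x * sinWave i k x + 2 * k * (pderiv i φ x * cosWave i k x)) := by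
  rw [laplacian_mul hφ (contDiff_sinWave i k), laplacian_sinWave]
  simp only [pderiv_sinWave, mul_ite, mul_zero, Finset.sum_ite_eq', Finset.mem_univ, if_true]
  ring

lemma sinWave_sq_add_cosWave_sq (i : Fin d) (k : ℝ) (x : EuclideanSpace ℝ (Fin d)) :
    sinWave i k x ^ 2 + cosWave i k x ^ 2 = 1 := Real.sin_sq_add_cos_sq _

/-- The squared gradients of the two modulations add up without oscillation. -/
lemma gradSq_mul_cosWave_add_gradSq_mul_sinWave {φ : EuclideanSpace ℝ (Fin d) → ℝ}
    (hφ : ContDiff ℝ (⊤ : ℕ∞) φ) (i : Fin d) (k : ℝ) (x : EuclideanSpace ℝ (Fin d)) :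
    gradSq (fun x => φ x * cosWave i k x) x + gradSq (fun x => φ x * sinWave i k x) x
      = gradSq φ x + k ^ 2 * φ x ^ 2 := by
  simp only [gradSq_eq_sum_pderiv, pderiv_mul hφ (contDiff_cosWave i k),
    pderiv_mul hφ (contDiff_sinWave i k), pderiv_cosWave, pderiv_sinWave]
  have h1 := sinWave_sq_add_cosWave_sq i k x
  have : k ^ 2 * φ x ^ 2 = ∑ j, if j = i then k ^ 2 * φ x ^ 2 else 0 := by simp
  rw [this, ← Finset.sum_add_distrib, ← Finset.sum_add_distrib]
  refine Finset.sum_congr rfl fun j _ => ?_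
  by_cases hj : j = i
  · subst hj
    simp only [if_true]
    linear_combination (pderiv j φ x ^ 2 + k ^ 2 * φ x ^ 2) * h1
  · simp only [hj, if_false]
    linear_combination (pderiv j φ x ^ 2) * h1

namespace IsTest

variable {φ ψ : EuclideanSpace ℝ (Fin d) → ℝ}

lemma continuous (hφ : IsTest φ) : Continuous φ := hφ.smooth.continuous

lemma exists_bound (hφ : IsTest φ) : ∃ C, 0 ≤ C ∧ ∀ x, |φ x| ≤ C := by
  obtain ⟨C, hC⟩ := hφ.compact.exists_bound_of_continuous hφ.continuous
  exact ⟨C, (norm_nonneg _).trans (hC 0), hC⟩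

lemma mul_smooth (hφ : IsTest φ) (hψ : ContDiff ℝ (⊤ : ℕ∞) ψ) :
    IsTest (fun x => φ x * ψ x) :=
  ⟨hφ.smooth.mul hψ, hφ.compact.mul_right⟩

lemma add (hφ : IsTest φ) (hψ : IsTest ψ) : IsTest (fun x => φ x + ψ x) :=
  ⟨hφ.smooth.add hψ.smooth, hφ.compact.add hψ.compact⟩

lemma sq (hφ : IsTest φ) : IsTest (fun x => φ x ^ 2) := by
  simpa only [_root_.sq] using hφ.mul_smooth hφ.smooth

lemma pderiv (hφ : IsTest φ) (i : Fin d) : IsTest (pderiv i φ) :=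
  ⟨contDiff_pderiv hφ.smooth i, hφ.compact.fderiv_apply ℝ _⟩

lemma finset_sum {ι : Type*} (s : Finset ι) {f : ι → EuclideanSpace ℝ (Fin d) → ℝ}
    (hf : ∀ i ∈ s, IsTest (f i)) : IsTest (fun x => ∑ i ∈ s, f i x) := by
  classical
  induction s using Finset.induction_on with
  | empty => exact ⟨by simpa using contDiff_const, by
      simp only [Finset.sum_empty]
      exact HasCompactSupport.zero⟩
  | insert a s ha ih =>
    simp only [Finset.sum_insert ha]
    exact (hf a (by simp)).add (ih fun i hi => hf i (by simp [hi]))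

lemma laplacian (hφ : IsTest φ) : IsTest (laplacian φ) :=
  finset_sum _ fun i _ => (hφ.pderiv i).pderiv i

lemma gradSq (hφ : IsTest φ) : IsTest (gradSq φ) := by
  rw [gradSq_eq_sum_pderiv]
  exact finset_sum _ fun i _ => (hφ.pderiv i).sq

lemma mul_cosWave (hφ : IsTest φ) (i : Fin d) (k : ℝ) : IsTest (fun x => φ x * cosWave i k x) :=
  hφ.mul_smooth (contDiff_cosWave i k)

lemma mul_sinWave (hφ : IsTest φ) (i : Fin d) (k : ℝ) : IsTest (fun x => φ x * sinWave i k x) :=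
  hφ.mul_smooth (contDiff_sinWave i k)

/-- A test function is unchanged by multiplication with a suitable test function. -/
lemma exists_cutoff (hφ : IsTest φ) : ∃ χ, IsTest χ ∧ ∀ x, φ x * χ x = φ x := by
  obtain ⟨R, hR⟩ := hφ.compact.isBounded.subset_closedBall (0 : EuclideanSpace ℝ (Fin d))
  let b : ContDiffBump (0 : EuclideanSpace ℝ (Fin d)) :=
    ⟨max R 1, max R 1 + 1, by positivity, by linarith⟩
  refine ⟨b, ⟨b.contDiff, b.hasCompactSupport⟩, fun x => ?_⟩
  by_cases hx : φ x = 0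
  · simp [hx]
  · have hx' := hR (subset_tsupport φ hx)
    rw [b.one_of_mem_closedBall (Metric.closedBall_subset_closedBall (le_max_left _ _) hx'),
      mul_one]

end IsTest

end Calculus

section Atoms

variable {X : Type*} [MeasurableSpace X]

lemma measureReal_eq_card_div_of_atoms {m : Measure X} {α : ℝ} {S : Finset X} [IsFiniteMeasure m]
    (hS : ∀ x ∈ S, m.real {x} = α⁻¹) (hm : m = ∑ x ∈ S, m {x} • Measure.dirac x)
    {B : Set X} (hB : MeasurableSet B) : ∃ n : ℕ, m.real B = n * α⁻¹ := by
  classical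
  refine ⟨(S.filter (· ∈ B)).card, ?_⟩
  have h : m B = ∑ x ∈ S, if x ∈ B then m {x} else 0 := by
    conv_lhs => rw [hm]
    rw [Measure.finsetSum_apply]
    refine Finset.sum_congr rfl fun x _ => ?_
    by_cases hx : x ∈ B <;> simp [hx, hB]
  rw [Measure.real, h, ← Finset.sum_filter, ENNReal.toReal_sum fun _ _ => measure_ne_top _ _,
    Finset.sum_congr rfl fun x hx =>
      show (m {x}).toReal = α⁻¹ from hS x (Finset.mem_filter.1 hx).1]
  simp

variable [MetricSpace X] [BorelSpace X]

lemma tendsto_measureReal_closedBall (m : Measure X) [IsFiniteMeasure m] (x : X) :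
    Tendsto (fun r => m.real (Metric.closedBall x r)) (𝓝[>] 0) (𝓝 (m.real {x})) := by
  have h := tendsto_measure_cthickening_of_isClosed (μ := m) (s := {x})
    ⟨1, one_pos, measure_ne_top _ _⟩ isClosed_singleton
  have h' := (ENNReal.tendsto_toReal (measure_ne_top m {x})).comp
    (h.mono_left (nhdsWithin_le_nhds (s := Ioi 0)))
  refine h'.congr' ?_
  filter_upwards [self_mem_nhdsWithin] with r hr
  simp [Metric.cthickening_singleton x (le_of_lt hr), Measure.real]

/-- If every ball centred in the support has mass at least `c > 0`, the measure is a finite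
sum of atoms of mass at least `c`. -/
lemma exists_finset_atoms [SecondCountableTopology X] (m : Measure X) [IsFiniteMeasure m] {c : ℝ} (hc : 0 < c)
    (h : ∀ x ∈ m.support, ∀ r > 0, c ≤ m.real (Metric.ball x r)) :
    ∃ S : Finset X, (∀ x ∈ S, c ≤ m.real {x}) ∧ m = ∑ x ∈ S, m {x} • Measure.dirac x := by
  have hatom : ∀ x ∈ m.support, c ≤ m.real {x} := by
    intro x hx
    refine ge_of_tendsto (tendsto_measureReal_closedBall m x) ?_
    filter_upwards [self_mem_nhdsWithin] with r hr
    exact (h x hx r hr).trans (measureReal_mono Metric.ball_subset_closedBall)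
  have hfin : m.support.Finite := by
    by_contra hinf
    obtain ⟨N, hN⟩ := exists_nat_gt (m.real univ / c)
    obtain ⟨t, ht, hcard⟩ := Set.Infinite.exists_subset_card_eq hinf N
    have h1 : ∑ x ∈ t, c ≤ ∑ x ∈ t, m.real {x} :=
      Finset.sum_le_sum fun x hx => hatom x (ht hx)
    have h2 : m.real (t : Set X) ≤ m.real univ := measureReal_mono (subset_univ _)
    rw [← sum_measureReal_singleton] at h2
    rw [Finset.sum_const, hcard, nsmul_eq_mul] at h1
    rw [div_lt_iff₀ hc] at hN
    linarith
  refine ⟨hfin.toFinset, fun x hx => hatom x (hfin.mem_toFinset.1 hx), ?_⟩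
  ext B hB
  rw [Measure.finsetSum_apply]
  have h1 : m B = m (B ∩ m.support) :=
    (measure_inter_conull' (measure_mono_null (fun _ hy => hy.2)
      Measure.measure_compl_support)).symm
  have h2 : B ∩ m.support = ⋃ x ∈ hfin.toFinset, (B ∩ {x}) := by
    ext y; simp [and_comm]
  rw [h1, h2, measure_biUnion_finset]
  · refine Finset.sum_congr rfl fun x _ => ?_
    by_cases hx : x ∈ B
    · have : B ∩ {x} = {x} := by simpa using hx
      simp [this, hx]
    · have : B ∩ {x} = ∅ := by simpa using hx
      simp [this, hx]
  · intro x _ y _ hxy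
    refine Set.disjoint_left.2 ?_
    rintro z ⟨_, rfl⟩ ⟨_, rfl⟩
    exact hxy rfl
  · intro x _
    exact hB.inter (measurableSet_singleton x)

/-- A probability measure giving mass in `α⁻¹ ℕ` to every ball with null boundary is
a normalised sum of `α` Dirac masses. -/
lemma exists_sum_dirac_of_ball_mem [SecondCountableTopology X] (m : Measure X)
    [IsProbabilityMeasure m] {α : ℝ} (hα : 0 < α)
    (h : ∀ x r, m (frontier (Metric.ball x r)) = 0 →
      α * m.real (Metric.ball x r) ∈ range ((↑) : ℕ → ℝ)) :
    ∃ n : ℕ, 0 < n ∧ α = n ∧ ∃ x : Fin n → X,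
      m = (n : ℝ≥0∞)⁻¹ • ∑ i : Fin n, Measure.dirac (x i) := by
  have hnull : ∀ (x : X) {r : ℝ}, 0 < r →
      ∃ s ∈ Ioo 0 r, m (frontier (Metric.ball x s)) = 0 := fun x r hr => by
    simpa only [Metric.thickening_singleton] using exists_null_frontier_thickening m {x} hr
  obtain ⟨S, hS, hmS⟩ := exists_finset_atoms m (inv_pos.2 hα) fun x hx r hr => by
    obtain ⟨s, hs, hs0⟩ := hnull x hr
    obtain ⟨k, hk⟩ := h x s hs0
    have hpos : 0 < m (Metric.ball x s) :=
      (Measure.mem_support_iff_forall x).1 hx _ (Metric.ball_mem_nhds x hs.1)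
    have hpos' : 0 < m.real (Metric.ball x s) := ENNReal.toReal_pos hpos.ne' (measure_ne_top _ _)
    have hk0 : (0 : ℝ) < k := hk ▸ mul_pos hα hpos'
    have hk1 : (1 : ℝ) ≤ k := by exact_mod_cast hk0
    have : m.real (Metric.ball x s) ≤ m.real (Metric.ball x r) :=
      measureReal_mono (Metric.ball_subset_ball hs.2.le)
    rw [inv_le_iff_one_le_mul₀ hα]
    nlinarith
  have hinteg : ∀ x, ∃ k : ℕ, (k : ℝ) = α * m.real {x} := by
    intro x
    choose! s hs hs0 using fun (r : ℝ) (hr : 0 < r) => hnull x hr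
    have hs_lim : Tendsto s (𝓝[>] 0) (𝓝[>] 0) := by
      refine tendsto_nhdsWithin_iff.2 ⟨?_, ?_⟩
      · refine tendsto_of_tendsto_of_tendsto_of_le_of_le' tendsto_const_nhds
          (tendsto_id.mono_left nhdsWithin_le_nhds) ?_ ?_
        · filter_upwards [self_mem_nhdsWithin] with r hr using (hs r hr).1.le
        · filter_upwards [self_mem_nhdsWithin] with r hr using (hs r hr).2.le
      · filter_upwards [self_mem_nhdsWithin] with r hr using (hs r hr).1
    have hball : Tendsto (fun r => m.real (Metric.ball x (s r))) (𝓝[>] 0) (𝓝 (m.real {x})) := by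
      refine tendsto_of_tendsto_of_tendsto_of_le_of_le' tendsto_const_nhds
        ((tendsto_measureReal_closedBall m x).comp hs_lim) ?_ ?_
      · filter_upwards [self_mem_nhdsWithin] with r hr
        exact measureReal_mono (by simpa using (hs r hr).1)
      · filter_upwards with r
        exact measureReal_mono Metric.ball_subset_closedBall
    refine Nat.isClosedEmbedding_coe_real.isClosed_range.mem_of_tendsto (hball.const_mul α) ?_
    filter_upwards [self_mem_nhdsWithin] with r hr using h x _ (hs0 r hr)
  choose k hk using hinteg
  have hmass : ∀ x, m {x} = (k x : ℝ≥0∞) * ENNReal.ofReal α⁻¹ := by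
    intro x
    have : m.real {x} = k x * α⁻¹ := by rw [hk]; field_simp
    rw [← ofReal_measureReal, this, ENNReal.ofReal_mul (by positivity), ENNReal.ofReal_natCast]
  have hαn : α = ∑ x ∈ S, k x := by
    have h1 : m.real univ = ∑ x ∈ S, m.real {x} := by
      conv_lhs => rw [hmS]
      rw [Measure.real, Measure.finsetSum_apply, ENNReal.toReal_sum]
      · simp [Measure.real]
      · intro x _
        simp
    simp only [probReal_univ] at h1
    push_cast
    simp only [hk, ← Finset.mul_sum, ← h1, mul_one]
  have hn : 0 < ∑ x ∈ S, k x := by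
    rw [hαn] at hα
    exact_mod_cast hα
  refine ⟨∑ x ∈ S, k x, hn, hαn, ?_⟩
  have hcard : Fintype.card (Σ x : S, Fin (k x)) = ∑ x ∈ S, k x := by
    simp [Finset.sum_attach S k]
  let e := Fintype.equivFinOfCardEq hcard
  refine ⟨fun i => (e.symm i).1, ?_⟩
  rw [Equiv.sum_comp e.symm fun y : (Σ x : S, Fin (k x)) => Measure.dirac (y.1 : X),
    Fintype.sum_sigma]
  have hinv : ENNReal.ofReal α⁻¹ = ((∑ x ∈ S, k x : ℕ) : ℝ≥0∞)⁻¹ := by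
    rw [ENNReal.ofReal_inv_of_pos hα, hαn, ENNReal.ofReal_natCast]
  conv_lhs => rw [hmS]
  simp only [Finset.sum_const, Finset.card_univ, Fintype.card_fin, Finset.smul_sum]
  rw [← Finset.sum_coe_sort S fun x => m {x} • Measure.dirac x]
  refine Finset.sum_congr rfl fun x _ => ?_
  rw [hmass, hinv, mul_comm, mul_smul, Nat.cast_smul_eq_nsmul]

end Atoms

section Defect

/-- The indicator function of `2πℤ`. -/
def periodicIndicator (θ : ℝ) : ℝ := if Real.cos θ = 1 then 1 else 0

lemma measurable_periodicIndicator : Measurable periodicIndicator :=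
  Measurable.ite (Real.measurable_cos (measurableSet_singleton 1)) measurable_const
    measurable_const

lemma periodicIndicator_nonneg (θ : ℝ) : 0 ≤ periodicIndicator θ := by
  unfold periodicIndicator; split_ifs <;> norm_num

lemma periodicIndicator_le_one (θ : ℝ) : periodicIndicator θ ≤ 1 := by
  unfold periodicIndicator; split_ifs <;> norm_num

/-- Cesàro means of `cos (j θ)`. -/
lemma tendsto_mean_cos (θ : ℝ) :
    Tendsto (fun n : ℕ => (n : ℝ)⁻¹ * ∑ j ∈ Finset.range n, Real.cos ((j + 1 : ℕ) * θ)) atTop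
      (𝓝 (periodicIndicator θ)) := by
  unfold periodicIndicator
  split_ifs with h
  · obtain ⟨k, hk⟩ := (Real.cos_eq_one_iff θ).1 h
    have : ∀ j : ℕ, Real.cos ((j + 1 : ℕ) * θ) = 1 := fun j => by
      rw [← hk]
      exact (Real.cos_eq_one_iff _).2 ⟨(j + 1 : ℕ) * k, by push_cast; ring⟩
    simp only [this]
    exact (tendsto_const_nhds (x := (1 : ℝ))).cesaro
  · set z : ℂ := Complex.exp (θ * Complex.I) with hz
    have hz1 : z ≠ 1 := by
      intro hz1
      apply h
      have := congrArg Complex.re hz1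
      rwa [hz, Complex.exp_ofReal_mul_I_re, Complex.one_re] at this
    have hnorm : ‖z‖ = 1 := Complex.norm_exp_ofReal_mul_I θ
    have hsum : ∀ n : ℕ, ∑ j ∈ Finset.range n, Real.cos ((j + 1 : ℕ) * θ)
        = (z * ((z ^ n - 1) / (z - 1))).re := fun n => by
      rw [← geom_sum_eq hz1, Finset.mul_sum, Complex.re_sum]
      refine Finset.sum_congr rfl fun j _ => ?_
      rw [← pow_succ', hz, ← Complex.exp_nat_mul, ← mul_assoc, ← Complex.ofReal_natCast,
        ← Complex.ofReal_mul, Complex.exp_ofReal_mul_I_re]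
    have hbound : ∀ n : ℕ, |∑ j ∈ Finset.range n, Real.cos ((j + 1 : ℕ) * θ)|
        ≤ 2 / ‖z - 1‖ := fun n => by
      rw [hsum]
      refine (Complex.abs_re_le_norm _).trans ?_
      rw [norm_mul, hnorm, one_mul, norm_div]
      gcongr
      refine (norm_sub_le _ _).trans ?_
      rw [norm_pow, hnorm]
      norm_num
    have hlim : Tendsto (fun n : ℕ => (n : ℝ)⁻¹ * (2 / ‖z - 1‖)) atTop (𝓝 0) := by
      simpa using (tendsto_inv_atTop_nhds_zero_nat (𝕜 := ℝ)).mul_const (2 / ‖z - 1‖)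
    refine squeeze_zero_norm (fun n => ?_) hlim
    rw [norm_mul, norm_inv, Real.norm_natCast]
    gcongr
    exact hbound n

variable {d : ℕ}

/-- The drift of `k⁻² |⟨m, φ e^{i k x}⟩|²` to leading order in `k`. -/
def waveDefect (α : ℝ) (i : Fin d) (φ : EuclideanSpace ℝ (Fin d) → ℝ) (k : ℝ)
    (m : ProbabilityMeasure (EuclideanSpace ℝ (Fin d))) : ℝ :=
  pairing m (fun x => φ x ^ 2)
    - α * (pairing m (fun x => φ x * cosWave i k x) ^ 2
      + pairing m (fun x => φ x * sinWave i k x) ^ 2)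

/-- The average of `waveDefect` over the frequencies `1, …, n`. -/
def meanDefect (α : ℝ) (i : Fin d) (φ : EuclideanSpace ℝ (Fin d) → ℝ) (n : ℕ)
    (m : ProbabilityMeasure (EuclideanSpace ℝ (Fin d))) : ℝ :=
  (n : ℝ)⁻¹ * ∑ j ∈ Finset.range n, waveDefect α i φ (j + 1 : ℕ) m

/-- The limit of `meanDefect` as the number of frequencies tends to infinity. -/
def limitDefect (α : ℝ) (i : Fin d) (φ : EuclideanSpace ℝ (Fin d) → ℝ)
    (m : ProbabilityMeasure (EuclideanSpace ℝ (Fin d))) : ℝ :=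
  pairing m (fun x => φ x ^ 2)
    - α * ∫ z, φ z.1 * φ z.2 * periodicIndicator (z.1 i - z.2 i)
      ∂(Measure.prod (m : Measure (EuclideanSpace ℝ (Fin d)))
        (m : Measure (EuclideanSpace ℝ (Fin d))))

lemma IsTest.integrable {φ : EuclideanSpace ℝ (Fin d) → ℝ} (hφ : IsTest φ)
    (m : Measure (EuclideanSpace ℝ (Fin d))) [IsFiniteMeasure m] : Integrable φ m :=
  hφ.continuous.integrable_of_hasCompactSupport hφ.compact

lemma abs_pairing_le (m : ProbabilityMeasure (EuclideanSpace ℝ (Fin d)))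
    {f : EuclideanSpace ℝ (Fin d) → ℝ} {C : ℝ} (hf : ∀ x, |f x| ≤ C) : |pairing m f| ≤ C := by
  have := norm_integral_le_of_norm_le_const (μ := (m : Measure (EuclideanSpace ℝ (Fin d))))
    (f := f) (C := C) (ae_of_all _ hf)
  simpa [pairing] using this

lemma cosWave_mul_add_sinWave_mul (i : Fin d) (k : ℝ) (x y : EuclideanSpace ℝ (Fin d)) :
    cosWave i k x * cosWave i k y + sinWave i k x * sinWave i k y
      = Real.cos (k * (x i - y i)) := by
  rw [mul_sub, Real.cos_sub]; rfl

lemma continuous_coord (i : Fin d) : Continuous fun x : EuclideanSpace ℝ (Fin d) => x i :=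
  (EuclideanSpace.proj (𝕜 := ℝ) i).continuous

lemma IsTest.integrable_prod_mul {φ : EuclideanSpace ℝ (Fin d) → ℝ} (hφ : IsTest φ)
    (m : Measure (EuclideanSpace ℝ (Fin d))) [IsFiniteMeasure m]
    {g : EuclideanSpace ℝ (Fin d) × EuclideanSpace ℝ (Fin d) → ℝ} (hg : Measurable g)
    (hg1 : ∀ z, |g z| ≤ 1) :
    Integrable (fun z : EuclideanSpace ℝ (Fin d) × EuclideanSpace ℝ (Fin d) =>
      φ z.1 * φ z.2 * g z) (m.prod m) :=
  ((hφ.integrable m).mul_prod (hφ.integrable m)).mul_bdd hg.aestronglyMeasurable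
    (ae_of_all _ hg1)

lemma pairing_cosWave_sq_add_pairing_sinWave_sq {φ : EuclideanSpace ℝ (Fin d) → ℝ}
    (hφ : IsTest φ) (i : Fin d) (k : ℝ) (m : ProbabilityMeasure (EuclideanSpace ℝ (Fin d))) :
    pairing m (fun x => φ x * cosWave i k x) ^ 2 + pairing m (fun x => φ x * sinWave i k x) ^ 2
      = ∫ z, φ z.1 * φ z.2 * Real.cos (k * (z.1 i - z.2 i))
        ∂(Measure.prod (m : Measure (EuclideanSpace ℝ (Fin d)))
          (m : Measure (EuclideanSpace ℝ (Fin d)))) := by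
  have hc := hφ.mul_cosWave i k
  have hs := hφ.mul_sinWave i k
  rw [sq, sq, pairing, pairing, ← integral_prod_mul, ← integral_prod_mul,
    ← integral_add ((hc.integrable _).mul_prod (hc.integrable _))
      ((hs.integrable _).mul_prod (hs.integrable _))]
  refine integral_congr_ae (ae_of_all _ fun z => ?_)
  simp only [← cosWave_mul_add_sinWave_mul]
  ring

lemma tendsto_meanDefect (α : ℝ) (i : Fin d) {φ : EuclideanSpace ℝ (Fin d) → ℝ} (hφ : IsTest φ)
    (m : ProbabilityMeasure (EuclideanSpace ℝ (Fin d))) :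
    Tendsto (fun n => meanDefect α i φ n m) atTop (𝓝 (limitDefect α i φ m)) := by
  set μ := (m : Measure (EuclideanSpace ℝ (Fin d)))
  obtain ⟨C, hC0, hC⟩ := hφ.exists_bound
  have hmeas : ∀ k : ℝ, Measurable
      fun z : EuclideanSpace ℝ (Fin d) × EuclideanSpace ℝ (Fin d) =>
        Real.cos (k * (z.1 i - z.2 i)) := fun k => by
    have := continuous_coord i
    exact Continuous.measurable (by fun_prop)
  have key : ∀ n : ℕ, 0 < n → meanDefect α i φ n m = pairing m (fun x => φ x ^ 2)
      - α * ∫ z, φ z.1 * φ z.2 * ((n : ℝ)⁻¹ * ∑ j ∈ Finset.range n,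
        Real.cos ((j + 1 : ℕ) * (z.1 i - z.2 i))) ∂(μ.prod μ) := by
    intro n hn
    have hn' : (n : ℝ) ≠ 0 := by positivity
    have h1 : ∫ z, φ z.1 * φ z.2 * ((n : ℝ)⁻¹ * ∑ j ∈ Finset.range n,
        Real.cos ((j + 1 : ℕ) * (z.1 i - z.2 i))) ∂(μ.prod μ)
        = (n : ℝ)⁻¹ * ∑ j ∈ Finset.range n, ∫ z, φ z.1 * φ z.2 *
        Real.cos ((j + 1 : ℕ) * (z.1 i - z.2 i)) ∂(μ.prod μ) := by
      rw [← integral_finsetSum _ fun j _ => hφ.integrable_prod_mul μ (hmeas _)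
        fun z => Real.abs_cos_le_one _, ← integral_const_mul]
      congr 1; ext z
      simp only [Finset.mul_sum]
      exact Finset.sum_congr rfl fun j _ => by ring
    rw [h1, meanDefect]
    simp only [waveDefect, pairing_cosWave_sq_add_pairing_sinWave_sq hφ, Finset.sum_sub_distrib,
      Finset.sum_const, Finset.card_range, nsmul_eq_mul, ← Finset.mul_sum]
    field_simp
    rfl
  have hlim : Tendsto (fun n : ℕ => ∫ z, φ z.1 * φ z.2 * ((n : ℝ)⁻¹ * ∑ j ∈ Finset.range n,
        Real.cos ((j + 1 : ℕ) * (z.1 i - z.2 i))) ∂(μ.prod μ)) atTop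
      (𝓝 (∫ z, φ z.1 * φ z.2 * periodicIndicator (z.1 i - z.2 i) ∂(μ.prod μ))) := by
    have hφc := hφ.continuous
    have hci := continuous_coord i
    refine tendsto_integral_of_dominated_convergence (fun _ => C * C) (fun n => ?_)
      (integrable_const _) (fun n => ae_of_all _ fun z => ?_)
      (ae_of_all _ fun z => (tendsto_mean_cos _).const_mul _)
    · exact Continuous.aestronglyMeasurable (by fun_prop)
    · rw [norm_mul, norm_mul]
      have h1 : ‖(n : ℝ)⁻¹ * ∑ j ∈ Finset.range n,
          Real.cos ((j + 1 : ℕ) * (z.1 i - z.2 i))‖ ≤ 1 := by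
        rw [norm_mul, norm_inv, Real.norm_natCast]
        refine inv_mul_le_one_of_le₀ ?_ (by positivity)
        refine (norm_sum_le_of_le _ fun j _ => Real.abs_cos_le_one _).trans ?_
        simp
      calc _ ≤ C * C * 1 := by gcongr <;> exact hC _
        _ = C * C := mul_one _
  refine ((tendsto_const_nhds.sub (hlim.const_mul α))).congr' ?_
  filter_upwards [eventually_gt_atTop 0] with n hn using (key n hn).symm

/-- A countable family of bump functions with arbitrarily small support near any point. -/
def bumpFamily (d : ℕ) (p : ℕ × ℕ) : EuclideanSpace ℝ (Fin d) → ℝ :=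
  (⟨((p.2 : ℝ) + 1)⁻¹, 2 * ((p.2 : ℝ) + 1)⁻¹, by positivity, by
    have : (0 : ℝ) < ((p.2 : ℝ) + 1)⁻¹ := by positivity
    linarith⟩ : ContDiffBump (TopologicalSpace.denseSeq (EuclideanSpace ℝ (Fin d)) p.1))

lemma isTest_bumpFamily (p : ℕ × ℕ) : IsTest (bumpFamily d p) :=
  ⟨ContDiffBump.contDiff _, ContDiffBump.hasCompactSupport _⟩

lemma exists_bumpFamily (x : EuclideanSpace ℝ (Fin d)) (n : ℕ) :
    ∃ p, (∀ y, 0 ≤ bumpFamily d p y) ∧ (∀ y, bumpFamily d p y ≤ 1) ∧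
      (∀ᶠ y in 𝓝 x, bumpFamily d p y = 1) ∧
      ∀ y, 3 * ((n : ℝ) + 1)⁻¹ ≤ dist y x → bumpFamily d p y = 0 := by
  have hpos : (0 : ℝ) < ((n : ℝ) + 1)⁻¹ := by positivity
  obtain ⟨q, hq⟩ := (TopologicalSpace.denseRange_denseSeq
    (EuclideanSpace ℝ (Fin d))).exists_dist_lt x hpos
  refine ⟨(q, n), fun y => ContDiffBump.nonneg _, fun y => ContDiffBump.le_one _, ?_, ?_⟩
  · filter_upwards [Metric.isOpen_ball.mem_nhds (Metric.mem_ball.2 hq)] with y hy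
    exact ContDiffBump.one_of_mem_closedBall _ (Metric.ball_subset_closedBall hy)
  · intro y hy
    refine ContDiffBump.zero_of_le_dist _ ?_
    have := dist_triangle_right y x (TopologicalSpace.denseSeq (EuclideanSpace ℝ (Fin d)) q)
    have := dist_triangle y (TopologicalSpace.denseSeq (EuclideanSpace ℝ (Fin d)) q) x
    rw [dist_comm] at hq
    change 2 * ((n : ℝ) + 1)⁻¹ ≤ _
    linarith

lemma inv_le_measureReal_ball_of_limitDefect {α : ℝ} (hα : 0 < α) (i : Fin d)
    (m : ProbabilityMeasure (EuclideanSpace ℝ (Fin d)))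
    (h : ∀ p, limitDefect α i (bumpFamily d p) m = 0)
    {x : EuclideanSpace ℝ (Fin d)} (hx : x ∈ (m : Measure (EuclideanSpace ℝ (Fin d))).support)
    {r : ℝ} (hr : 0 < r) :
    α⁻¹ ≤ (m : Measure (EuclideanSpace ℝ (Fin d))).real (Metric.ball x r) := by
  set μ := (m : Measure (EuclideanSpace ℝ (Fin d)))
  obtain ⟨n, hn⟩ : ∃ n : ℕ, ((n : ℝ) + 1)⁻¹ < r / 3 := by
    simpa only [one_div] using exists_nat_one_div_lt (show 0 < r / 3 by positivity)
  obtain ⟨p, hp0, -, hp1, hp2⟩ := exists_bumpFamily x n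
  have hd := h p
  have htest := isTest_bumpFamily (d := d) p
  set φ := bumpFamily d p
  set S := ∫ y, φ y ^ 2 ∂μ with hS
  have hci := continuous_coord i
  have hSint : Integrable (fun y => φ y ^ 2) μ := htest.sq.integrable μ
  have hSpos : 0 < S := by
    rw [hS, integral_pos_iff_support_of_nonneg (fun y => sq_nonneg _) hSint]
    refine lt_of_lt_of_le ((Measure.mem_support_iff_forall x).1 hx _ hp1) (measure_mono ?_)
    intro y (hy : φ y = 1)
    simp [hy]
  have hI : ∫ z, φ z.1 * φ z.2 * periodicIndicator (z.1 i - z.2 i) ∂(μ.prod μ)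
      ≤ S * μ.real (Metric.ball x r) := by
    set B := (Metric.ball x r).indicator (fun _ => (1 : ℝ)) with hB
    have hBint : Integrable B μ := (integrable_const 1).indicator measurableSet_ball
    have hBval : ∫ y, B y ∂μ = μ.real (Metric.ball x r) := by
      rw [hB, integral_indicator measurableSet_ball]; simp
    have h1 : ∫ z, (φ z.1 ^ 2 * B z.2 + B z.1 * φ z.2 ^ 2) / 2 ∂(μ.prod μ)
        = S * μ.real (Metric.ball x r) := by
      rw [integral_div, integral_add (hSint.mul_prod hBint) (hBint.mul_prod hSint),
        integral_prod_mul (fun y => φ y ^ 2) B, integral_prod_mul B (fun y => φ y ^ 2), hBval]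
      ring
    rw [← h1]
    refine integral_mono (htest.integrable_prod_mul μ ?_ ?_)
      (((hSint.mul_prod hBint).add (hBint.mul_prod hSint)).div_const 2) fun z => ?_
    · exact measurable_periodicIndicator.comp (Continuous.measurable (by fun_prop))
    · intro z
      rw [abs_of_nonneg (periodicIndicator_nonneg _)]
      exact periodicIndicator_le_one _
    · have hφB : ∀ y, φ y = φ y * B y := fun y => by
        by_cases hy : y ∈ Metric.ball x r
        · simp [hB, hy]
        · rw [hp2 y, zero_mul]
          rw [Metric.mem_ball, not_lt] at hy
          linarith
      have hB01 : ∀ y, B y = 0 ∨ B y = 1 := fun y => by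
        by_cases hy : y ∈ Metric.ball x r <;> simp [hB, hy]
      have h2 : φ z.1 * φ z.2 * periodicIndicator (z.1 i - z.2 i) ≤ φ z.1 * φ z.2 :=
        mul_le_of_le_one_right (mul_nonneg (hp0 _) (hp0 _)) (periodicIndicator_le_one _)
      refine h2.trans ?_
      rcases hB01 z.1 with h3 | h3
      · have h4 : φ z.1 = 0 := by rw [hφB, h3, mul_zero]
        rw [h4, h3]; simp
      rcases hB01 z.2 with h3' | h3'
      · have h4 : φ z.2 = 0 := by rw [hφB, h3', mul_zero]
        rw [h4, h3']; simp
      rw [h3, h3']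
      nlinarith [sq_nonneg (φ z.1 - φ z.2)]
  have hd' : S = α * ∫ z, φ z.1 * φ z.2 * periodicIndicator (z.1 i - z.2 i) ∂(μ.prod μ) := by
    rw [limitDefect, sub_eq_zero] at hd
    exact hd
  rw [inv_le_iff_one_le_mul₀ hα]
  have h5 : S ≤ α * (S * μ.real (Metric.ball x r)) := by
    calc S = _ := hd'
      _ ≤ _ := by gcongr
  by_contra hlt
  push Not at hlt
  nlinarith

lemma measureReal_singleton_of_limitDefect {α : ℝ} (i : Fin d)
    (m : ProbabilityMeasure (EuclideanSpace ℝ (Fin d)))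
    (h : ∀ p, limitDefect α i (bumpFamily d p) m = 0) (x : EuclideanSpace ℝ (Fin d)) :
    (m : Measure (EuclideanSpace ℝ (Fin d))).real {x}
      = α * (m : Measure (EuclideanSpace ℝ (Fin d))).real {x} ^ 2 := by
  set μ := (m : Measure (EuclideanSpace ℝ (Fin d)))
  choose p hp0 hp1 hpx hp2 using fun n => exists_bumpFamily x n
  have hci := continuous_coord i
  have hind : ∀ n, Continuous (bumpFamily d (p n)) := fun n => (isTest_bumpFamily _).continuous
  have hlim : ∀ y, Tendsto (fun n => bumpFamily d (p n) y) atTop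
      (𝓝 (({x} : Set (EuclideanSpace ℝ (Fin d))).indicator (fun _ => (1 : ℝ)) y)) := by
    intro y
    by_cases hy : y = x
    · subst hy
      simp [fun n => (hpx n).self_of_nhds]
    · rw [indicator_of_notMem (by simpa using hy)]
      refine tendsto_const_nhds.congr' ?_
      have h3 : Tendsto (fun n : ℕ => 3 * ((n : ℝ) + 1)⁻¹) atTop (𝓝 0) := by
        have := (tendsto_one_div_add_atTop_nhds_zero_nat (𝕜 := ℝ)).const_mul 3
        simpa using this
      filter_upwards [h3.eventually (gt_mem_nhds (dist_pos.2 hy))] with n hn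
      exact (hp2 n y hn.le).symm
  have habs : ∀ n y, |bumpFamily d (p n) y| ≤ 1 := fun n y => by
    rw [abs_of_nonneg (hp0 n y)]; exact hp1 n y
  have hL : Tendsto (fun n => ∫ y, bumpFamily d (p n) y ^ 2 ∂μ) atTop (𝓝 (μ.real {x})) := by
    have : μ.real {x} = ∫ y, (({x} : Set (EuclideanSpace ℝ (Fin d))).indicator
        (fun _ => (1 : ℝ)) y) ^ 2 ∂μ := by
      have h2 : ∀ y, (({x} : Set (EuclideanSpace ℝ (Fin d))).indicator (fun _ => (1 : ℝ)) y) ^ 2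
          = ({x} : Set (EuclideanSpace ℝ (Fin d))).indicator (fun _ => (1 : ℝ)) y := fun y => by
        by_cases hy : y = x <;> simp [hy]
      simp only [h2]
      rw [integral_indicator (measurableSet_singleton x)]; simp [Measure.real]
    rw [this]
    refine tendsto_integral_of_dominated_convergence (fun _ => 1)
      (fun n => ((hind n).pow 2).aestronglyMeasurable) (integrable_const _)
      (fun n => ae_of_all _ fun y => ?_) (ae_of_all _ fun y => (hlim y).pow 2)
    rw [norm_pow]
    exact pow_le_one₀ (norm_nonneg _) (habs n y)
  have hR : Tendsto (fun n => ∫ z, bumpFamily d (p n) z.1 * bumpFamily d (p n) z.2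
      * periodicIndicator (z.1 i - z.2 i) ∂(μ.prod μ)) atTop (𝓝 (μ.real {x} ^ 2)) := by
    set I := ({x} : Set (EuclideanSpace ℝ (Fin d))).indicator (fun _ => (1 : ℝ)) with hI
    have : μ.real {x} ^ 2 = ∫ z, I z.1 * I z.2 * periodicIndicator (z.1 i - z.2 i)
        ∂(μ.prod μ) := by
      have h2 : ∀ z : EuclideanSpace ℝ (Fin d) × EuclideanSpace ℝ (Fin d),
          I z.1 * I z.2 * periodicIndicator (z.1 i - z.2 i) = I z.1 * I z.2 := fun z => by
        by_cases h1 : z.1 = x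
        · by_cases h2 : z.2 = x
          · simp [h1, h2, periodicIndicator]
          · simp [hI, h2]
        · simp [hI, h1]
      simp only [h2]
      rw [integral_prod_mul I I, hI, integral_indicator (measurableSet_singleton x)]
      simp [sq, Measure.real]
    rw [this]
    refine tendsto_integral_of_dominated_convergence (fun _ => 1) (fun n => ?_)
      (integrable_const _) (fun n => ae_of_all _ fun z => ?_)
      (ae_of_all _ fun z => ((hlim z.1).mul (hlim z.2)).mul_const _)
    · refine ((((hind n).comp continuous_fst).mul
        ((hind n).comp continuous_snd)).aestronglyMeasurable).mul ?_
      exact (measurable_periodicIndicator.comp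
        (Continuous.measurable (by fun_prop))).aestronglyMeasurable
    · rw [norm_mul, norm_mul]
      have h3 : ‖periodicIndicator (z.1 i - z.2 i)‖ ≤ 1 := by
        rw [Real.norm_of_nonneg (periodicIndicator_nonneg _)]
        exact periodicIndicator_le_one _
      calc _ ≤ (1 : ℝ) * 1 * 1 := by gcongr <;> exact habs _ _
        _ = 1 := by norm_num
  refine tendsto_nhds_unique hL ((hR.const_mul α).congr fun n => ?_)
  have := h (p n)
  rw [limitDefect, sub_eq_zero] at this
  exact this.symm

/-- If all limit defects of a measure vanish, every set has mass in `α⁻¹ ℕ`. -/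
lemma mem_range_natCast_of_limitDefect {α : ℝ} (hα : 0 < α) (i : Fin d)
    (m : ProbabilityMeasure (EuclideanSpace ℝ (Fin d)))
    (h : ∀ p, limitDefect α i (bumpFamily d p) m = 0)
    {B : Set (EuclideanSpace ℝ (Fin d))} (hB : MeasurableSet B) :
    α * (m : Measure (EuclideanSpace ℝ (Fin d))).real B ∈ range ((↑) : ℕ → ℝ) := by
  obtain ⟨S, hS, hm⟩ := exists_finset_atoms (m : Measure (EuclideanSpace ℝ (Fin d)))
    (inv_pos.2 hα) fun x hx r hr => inv_le_measureReal_ball_of_limitDefect hα i m h hx hr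
  have hS' : ∀ x ∈ S, (m : Measure (EuclideanSpace ℝ (Fin d))).real {x} = α⁻¹ := by
    intro x hx
    have h1 := measureReal_singleton_of_limitDefect i m h x
    have h2 : (m : Measure (EuclideanSpace ℝ (Fin d))).real {x} ≠ 0 :=
      ((inv_pos.2 hα).trans_le (hS x hx)).ne'
    refine eq_inv_of_mul_eq_one_right (mul_left_cancel₀ h2 ?_)
    linarith
  obtain ⟨n, hn⟩ := measureReal_eq_card_div_of_atoms hS' hm hB
  exact ⟨n, by rw [hn]; field_simp⟩

end Defect

section Pairing

variable {d : ℕ} {f g : EuclideanSpace ℝ (Fin d) → ℝ}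

lemma pairing_add (m : ProbabilityMeasure (EuclideanSpace ℝ (Fin d))) (hf : IsTest f)
    (hg : IsTest g) : pairing m (fun x => f x + g x) = pairing m f + pairing m g :=
  integral_add (hf.integrable _) (hg.integrable _)

lemma pairing_const_mul (m : ProbabilityMeasure (EuclideanSpace ℝ (Fin d))) (c : ℝ)
    (f : EuclideanSpace ℝ (Fin d) → ℝ) : pairing m (fun x => c * f x) = c * pairing m f :=
  integral_const_mul _ _

lemma IsTest.continuous_pairing (hf : IsTest f) :
    Continuous fun m : ProbabilityMeasure (EuclideanSpace ℝ (Fin d)) => pairing m f := by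
  obtain ⟨C, -, hC⟩ := hf.exists_bound
  exact ProbabilityMeasure.continuous_integral_boundedContinuousFunction
    (BoundedContinuousFunction.ofNormedAddCommGroup f hf.continuous C hC)

end Pairing

section BoundedProcesses

variable {Ω : Type*} {mΩ : MeasurableSpace Ω}

lemma measurable_intervalIntegral_of_continuous {X : ℝ → Ω → ℝ}
    (hc : ∀ ω, Continuous fun t => X t ω) (hm : ∀ t, Measurable (X t)) (s t : ℝ) :
    Measurable fun ω => ∫ r in s..t, X r ω := by
  have h := stronglyMeasurable_uncurry_of_continuous_of_stronglyMeasurable hc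
    fun t => (hm t).stronglyMeasurable
  simp only [intervalIntegral]
  exact ((h.integral_prod_left' (μ := volume.restrict (Ioc s t))).sub
    (h.integral_prod_left' (μ := volume.restrict (Ioc t s)))).measurable

variable {P : Measure Ω} [IsProbabilityMeasure P]

lemma integrable_of_abs_le {Y : Ω → ℝ} (hY : AEStronglyMeasurable Y P) {C : ℝ}
    (hC : ∀ ω, |Y ω| ≤ C) : Integrable Y P :=
  Integrable.of_bound hY C (ae_of_all _ hC)

lemma abs_integral_le_of_abs_le {Y : Ω → ℝ} {C : ℝ} (hC : ∀ ω, |Y ω| ≤ C) :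
    |∫ ω, Y ω ∂P| ≤ C := by
  have := norm_integral_le_of_norm_le_const (μ := P) (f := Y) (C := C) (ae_of_all _ hC)
  simpa using this

/-- Fubini's theorem for a bounded continuous process. -/
lemma integral_mul_intervalIntegral_swap {X : ℝ → Ω → ℝ}
    (hc : ∀ ω, Continuous fun t => X t ω) (hm : ∀ t, Measurable (X t)) {s t C K : ℝ}
    (hst : s ≤ t) (hX : ∀ r ∈ Icc s t, ∀ ω, |X r ω| ≤ C) {Y : Ω → ℝ}
    (hY : AEStronglyMeasurable Y P) (hK : ∀ ω, |Y ω| ≤ K) :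
    ∫ ω, Y ω * (∫ r in s..t, X r ω) ∂P = ∫ r in s..t, ∫ ω, Y ω * X r ω ∂P := by
  have h := stronglyMeasurable_uncurry_of_continuous_of_stronglyMeasurable hc
    fun t => (hm t).stronglyMeasurable
  rw [intervalIntegral_integral_swap]
  · simp only [intervalIntegral.integral_const_mul]
  · have hprod : AEStronglyMeasurable (Function.uncurry fun r ω => Y ω * X r ω)
        ((volume.restrict (uIoc s t)).prod P) := hY.comp_snd.mul h.aestronglyMeasurable
    have : IsFiniteMeasure (volume.restrict (uIoc s t)) := by
      rw [uIoc_of_le hst]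
      infer_instance
    refine Integrable.of_bound hprod (K * C) ?_
    have hmem : ∀ᵐ z ∂((volume.restrict (uIoc s t)).prod P), z.1 ∈ uIoc s t :=
      Measure.quasiMeasurePreserving_fst.ae (ae_restrict_mem measurableSet_uIoc)
    filter_upwards [hmem] with z hz
    rw [uIoc_of_le hst] at hz
    simp only [Function.uncurry, norm_mul]
    exact mul_le_mul (hK _) (hX _ ⟨hz.1.le, hz.2⟩ _) (norm_nonneg _)
      ((abs_nonneg _).trans (hK z.2))

lemma abs_intervalIntegral_le {f : ℝ → ℝ} {s t C : ℝ} (hst : s ≤ t)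
    (hf : ∀ r ∈ Icc s t, |f r| ≤ C) : |∫ r in s..t, f r| ≤ C * (t - s) := by
  have := intervalIntegral.norm_integral_le_of_norm_le_const (a := s) (b := t) (f := f) (C := C)
    fun r hr => hf r (by rw [uIoc_of_le hst] at hr; exact ⟨hr.1.le, hr.2⟩)
  rwa [abs_of_nonneg (sub_nonneg.2 hst)] at this

/-- Increments of a bounded martingale are orthogonal to the past. -/
lemma MartingaleOn.integral_mul_sub_eq_zero {ℱ : Filtration ℝ mΩ} {T : ℝ} {X X' : ℝ → Ω → ℝ}
    (hX : MartingaleOn X ℱ P T) (hX' : ∀ t ∈ Icc 0 T, X t =ᵐ[P] X' t)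
    (hbdd : ∀ t ∈ Icc 0 T, ∃ C, ∀ ω, |X' t ω| ≤ C) {s t : ℝ} (hs : 0 ≤ s) (hst : s ≤ t)
    (ht : t ≤ T) {Y : Ω → ℝ} (hY : AEStronglyMeasurable[ℱ s] Y P) {K : ℝ}
    (hK : ∀ ω, |Y ω| ≤ K) : ∫ ω, Y ω * (X' t ω - X' s ω) ∂P = 0 := by
  have hmeas : ∀ r ∈ Icc 0 T, AEStronglyMeasurable (X' r) P := fun r hr =>
    (((hX.1 r hr.1 hr.2).mono (ℱ.le r)).aestronglyMeasurable).congr (hX' r hr)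
  have hYm : AEStronglyMeasurable Y P := hY.mono (ℱ.le s)
  have hinteg : ∀ r ∈ Icc 0 T, Integrable (X' r) P := fun r hr => by
    obtain ⟨C, hC⟩ := hbdd r hr
    exact integrable_of_abs_le (hmeas r hr) hC
  have hintY : ∀ r ∈ Icc 0 T, Integrable (Y * X' r) P := fun r hr =>
    (hinteg r hr).bdd_mul hYm (ae_of_all _ hK)
  have hsI : s ∈ Icc 0 T := ⟨hs, hst.trans ht⟩
  have htI : t ∈ Icc 0 T := ⟨hs.trans hst, ht⟩
  have h1 : P[Y * X' t | ℱ s] =ᵐ[P] Y * X' s := by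
    have h2 := condExp_mul_of_aestronglyMeasurable_left hY (hintY t htI) (hinteg t htI)
    have h3 := (condExp_congr_ae (m := ℱ s) (hX' t htI)).symm.trans (hX.2 s t hs hst ht)
    filter_upwards [h2, h3, hX' s hsI] with ω h2 h3 h4
    rw [h2, Pi.mul_apply, Pi.mul_apply, h3, h4]
  have h5 : ∫ ω, (Y * X' t) ω ∂P = ∫ ω, (Y * X' s) ω ∂P := by
    rw [← integral_condExp (ℱ.le s)]
    exact integral_congr_ae h1
  have h6 := integral_sub (hintY t htI) (hintY s hsI)
  simp only [Pi.mul_apply] at h5 h6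
  simp only [mul_sub]
  rw [h6, h5, sub_self]

end BoundedProcesses

section Regular

variable {d : ℕ} {Ω : Type*} {mΩ : MeasurableSpace Ω}

/-- The martingale part of `⟨μ_t, φ⟩`. -/
def martPart (α : ℝ) (μ : ℝ → Ω → ProbabilityMeasure (EuclideanSpace ℝ (Fin d)))
    (φ : EuclideanSpace ℝ (Fin d) → ℝ) (t : ℝ) (ω : Ω) : ℝ :=
  pairing (μ t ω) φ - pairing (μ 0 ω) φ
    - (α / 2) * ∫ s in (0 : ℝ)..t, pairing (μ s ω) (laplacian φ)

/-- The prescribed quadratic variation of the martingale part of `⟨μ_t, φ⟩`. -/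
def quadVar (μ : ℝ → Ω → ProbabilityMeasure (EuclideanSpace ℝ (Fin d)))
    (φ : EuclideanSpace ℝ (Fin d) → ℝ) (t : ℝ) (ω : Ω) : ℝ :=
  ∫ s in (0 : ℝ)..t, pairing (μ s ω) (gradSq φ)

/-- A solution of the martingale problem all of whose paths are continuous, with the martingale
properties expressed by orthogonality to bounded variables from the past. -/
structure IsRegularSolution (T α : ℝ) (ℱ : Filtration ℝ mΩ) (P : Measure Ω)
    (μ : ℝ → Ω → ProbabilityMeasure (EuclideanSpace ℝ (Fin d))) : Prop where
  cont : ∀ ω, Continuous fun t => μ t ω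
  init : ∃ μ0, ∀ ω, μ 0 ω = μ0
  clamp : ∀ t, ∃ s ∈ Icc 0 T, μ t = μ s
  meas_martPart : ∀ φ, IsTest φ → ∀ t ∈ Icc 0 T, Measurable (martPart α μ φ t)
  meas_quadVar : ∀ φ, IsTest φ → ∀ t ∈ Icc 0 T, Measurable (quadVar μ φ t)
  adapted_martPart : ∀ φ, IsTest φ → ∀ t ∈ Icc 0 T,
    AEStronglyMeasurable[ℱ t] (martPart α μ φ t) P
  adapted_quadVar : ∀ φ, IsTest φ → ∀ t ∈ Icc 0 T, AEStronglyMeasurable[ℱ t] (quadVar μ φ t) P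
  orth : ∀ φ, IsTest φ → ∀ s t, 0 ≤ s → s ≤ t → t ≤ T → ∀ (Y : Ω → ℝ) (K : ℝ),
    AEStronglyMeasurable[ℱ s] Y P → (∀ ω, |Y ω| ≤ K) →
    ∫ ω, Y ω * (martPart α μ φ t ω - martPart α μ φ s ω) ∂P = 0
  orth_sq : ∀ φ, IsTest φ → ∀ s t, 0 ≤ s → s ≤ t → t ≤ T → ∀ (Y : Ω → ℝ) (K : ℝ),
    AEStronglyMeasurable[ℱ s] Y P → (∀ ω, |Y ω| ≤ K) →
    ∫ ω, Y ω * ((martPart α μ φ t ω ^ 2 - quadVar μ φ t ω)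
      - (martPart α μ φ s ω ^ 2 - quadVar μ φ s ω)) ∂P = 0

lemma abs_martPart_le {α T : ℝ} {μ : ℝ → Ω → ProbabilityMeasure (EuclideanSpace ℝ (Fin d))}
    {φ : EuclideanSpace ℝ (Fin d) → ℝ} (hφ : IsTest φ) :
    ∃ C, ∀ t ∈ Icc 0 T, ∀ ω, |martPart α μ φ t ω| ≤ C := by
  obtain ⟨C, hC0, hC⟩ := hφ.exists_bound
  obtain ⟨D, hD0, hD⟩ := hφ.laplacian.exists_bound
  refine ⟨C + C + |α / 2| * (D * T), fun t ht ω => ?_⟩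
  refine (abs_sub _ _).trans (add_le_add ((abs_sub _ _).trans
    (add_le_add (abs_pairing_le _ hC) (abs_pairing_le _ hC))) ?_)
  rw [abs_mul]
  gcongr
  refine (abs_intervalIntegral_le ht.1 fun r _ => abs_pairing_le _ hD).trans ?_
  gcongr
  linarith [ht.2]

lemma abs_quadVar_le {T : ℝ} {μ : ℝ → Ω → ProbabilityMeasure (EuclideanSpace ℝ (Fin d))}
    {φ : EuclideanSpace ℝ (Fin d) → ℝ} (hφ : IsTest φ) :
    ∃ C, ∀ t ∈ Icc 0 T, ∀ ω, |quadVar μ φ t ω| ≤ C := by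
  obtain ⟨D, hD0, hD⟩ := hφ.gradSq.exists_bound
  refine ⟨D * T, fun t ht ω => ?_⟩
  refine (abs_intervalIntegral_le ht.1 fun r _ => abs_pairing_le _ hD).trans ?_
  gcongr
  linarith [ht.2]

/-- A solution of the martingale problem is indistinguishable from a regular one. -/
lemma IsMPSolution.exists_isRegularSolution {T α : ℝ} (hT : 0 < T) {P : Measure Ω}
    [IsProbabilityMeasure P] {ℱ : Filtration ℝ mΩ}
    {μ0 : ProbabilityMeasure (EuclideanSpace ℝ (Fin d))}
    {μ : ℝ → Ω → ProbabilityMeasure (EuclideanSpace ℝ (Fin d))}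
    (hsol : IsMPSolution d T α ℱ P μ0 μ) :
    ∃ ν : ℝ → Ω → ProbabilityMeasure (EuclideanSpace ℝ (Fin d)),
      IsRegularSolution T α ℱ P ν ∧ ∀ ω, ν 0 ω = μ0 := by
  classical
  obtain ⟨G, hGP, hGm, hG⟩ := (hsol.init.and hsol.cont).exists_measurable_mem
  let ν : ℝ → Ω → ProbabilityMeasure (EuclideanSpace ℝ (Fin d)) := fun t ω =>
    if ω ∈ G then μ (projIcc 0 T hT.le t) ω else μ0
  have hνG : ∀ ω ∈ G, ∀ t ∈ Icc 0 T, ν t ω = μ t ω := fun ω hω t ht => by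
    simp [ν, hω, projIcc_of_mem hT.le ht]
  have hνG' : ∀ ω ∉ G, ∀ t, ν t ω = μ0 := fun ω hω t => by simp [ν, hω]
  have h0 : ∀ ω, ν 0 ω = μ0 := fun ω => by
    by_cases hω : ω ∈ G
    · rw [hνG ω hω 0 ⟨le_rfl, hT.le⟩, (hG ω hω).1]
    · exact hνG' ω hω 0
  have hinteg : ∀ ω ∈ G, ∀ t ∈ Icc 0 T, ∀ f : EuclideanSpace ℝ (Fin d) → ℝ,
      ∫ s in (0 : ℝ)..t, pairing (ν s ω) f = ∫ s in (0 : ℝ)..t, pairing (μ s ω) f := by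
    intro ω hω t ht f
    refine intervalIntegral.integral_congr fun s hs => ?_
    rw [uIcc_of_le ht.1] at hs
    simp only [hνG ω hω s ⟨hs.1, hs.2.trans ht.2⟩]
  have hmartG : ∀ φ, ∀ t ∈ Icc 0 T, ∀ ω ∈ G, martPart α ν φ t ω = pairing (μ t ω) φ
      - pairing μ0 φ - (α / 2) * ∫ s in (0:ℝ)..t, pairing (μ s ω) (laplacian φ) := by
    intro φ t ht ω hω
    rw [martPart, hinteg ω hω t ht, h0, hνG ω hω t ht]
  have hquadG : ∀ φ, ∀ t ∈ Icc 0 T, ∀ ω ∈ G,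
      quadVar ν φ t ω = ∫ s in (0:ℝ)..t, pairing (μ s ω) (gradSq φ) := by
    intro φ t ht ω hω
    rw [quadVar, hinteg ω hω t ht]
  have hmeas_of_G : ∀ (X X' : Ω → ℝ), Measurable X → (∀ ω ∈ G, X' ω = X ω) →
      (∃ c, ∀ ω ∉ G, X' ω = c) → Measurable X' := by
    rintro X X' hX h1 ⟨c, h2⟩
    have : X' = G.piecewise X fun _ => c := by
      funext ω
      by_cases hω : ω ∈ G
      · simp [hω, h1]
      · simp [hω, h2]
    rw [this]
    exact hX.piecewise hGm measurable_const
  have hconstI : ∀ (t : ℝ) (f : EuclideanSpace ℝ (Fin d) → ℝ), ∀ ω ∉ G,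
      ∫ s in (0 : ℝ)..t, pairing (ν s ω) f = t * pairing μ0 f := by
    intro t f ω hω
    simp [hνG' ω hω]
  have hmartC : ∀ φ t, ∃ c, ∀ ω ∉ G, martPart α ν φ t ω = c := fun φ t =>
    ⟨_, fun ω hω => by rw [martPart, hconstI t _ ω hω, hνG' ω hω, hνG' ω hω]⟩
  have hae : ∀ {X X' : Ω → ℝ}, (∀ ω ∈ G, X' ω = X ω) → X =ᵐ[P] X' := fun h => by
    filter_upwards [hGP] with ω hω using (h ω hω).symm
  have hm1 : ∀ φ, IsTest φ → ∀ t ∈ Icc 0 T, Measurable (martPart α ν φ t) := fun φ hφ t ht =>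
    hmeas_of_G _ _ (((hsol.mart φ hφ.smooth hφ.compact).1 t ht.1 ht.2).mono (ℱ.le t)).measurable
      (hmartG φ t ht) (hmartC φ t)
  have hm2 : ∀ φ, IsTest φ → ∀ t ∈ Icc 0 T,
      AEStronglyMeasurable[ℱ t] (martPart α ν φ t) P := fun φ hφ t ht =>
    ((hsol.mart φ hφ.smooth hφ.compact).1 t ht.1 ht.2).aestronglyMeasurable.congr
      (hae (hmartG φ t ht))
  have hdiffG : ∀ φ, ∀ t ∈ Icc 0 T, ∀ ω ∈ G, martPart α ν φ t ω ^ 2 - quadVar ν φ t ω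
      = (pairing (μ t ω) φ - pairing μ0 φ
        - (α / 2) * ∫ s in (0:ℝ)..t, pairing (μ s ω) (laplacian φ)) ^ 2
        - ∫ s in (0:ℝ)..t, pairing (μ s ω) (gradSq φ) := by
    intro φ t ht ω hω
    rw [hmartG φ t ht ω hω, hquadG φ t ht ω hω]
  have hquad : ∀ φ t, quadVar ν φ t
      = fun ω => martPart α ν φ t ω ^ 2 - (martPart α ν φ t ω ^ 2 - quadVar ν φ t ω) := by
    intro φ t; funext ω; ring
  refine ⟨ν, ⟨?_, ⟨μ0, h0⟩, ?_, hm1, ?_, hm2, ?_, ?_, ?_⟩, h0⟩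
  · intro ω
    by_cases hω : ω ∈ G
    · simp only [ν, hω, if_true]
      exact (continuousOn_iff_continuous_domRestrict.1 (hG ω hω).2).comp continuous_projIcc
    · simp only [ν, hω, if_false]
      exact continuous_const
  · refine fun t => ⟨projIcc 0 T hT.le t, (projIcc 0 T hT.le t).2, ?_⟩
    funext ω
    simp [ν]
  · intro φ hφ t ht
    rw [hquad]
    refine ((hm1 φ hφ t ht).pow_const 2).sub (hmeas_of_G _ _
      (((hsol.qvar φ hφ.smooth hφ.compact).1 t ht.1 ht.2).mono (ℱ.le t)).measurable
      (hdiffG φ t ht) ?_)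
    obtain ⟨c, hc⟩ := hmartC φ t
    exact ⟨_, fun ω hω => by rw [hc ω hω, quadVar, hconstI t _ ω hω]⟩
  · intro φ hφ t ht
    rw [hquad]
    exact ((hm2 φ hφ t ht).pow 2).sub
      (((hsol.qvar φ hφ.smooth hφ.compact).1 t ht.1 ht.2).aestronglyMeasurable.congr
        (hae (hdiffG φ t ht)))
  · intro φ hφ s t hs hst ht Y K hY hK
    refine (hsol.mart φ hφ.smooth hφ.compact).integral_mul_sub_eq_zero
      (fun r hr => hae (hmartG φ r hr)) (fun r hr => ?_) hs hst ht hY hK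
    obtain ⟨C, hC⟩ := abs_martPart_le (α := α) (T := T) (μ := ν) hφ
    exact ⟨C, hC r hr⟩
  · intro φ hφ s t hs hst ht Y K hY hK
    refine (hsol.qvar φ hφ.smooth hφ.compact).integral_mul_sub_eq_zero
      (X' := fun t ω => martPart α ν φ t ω ^ 2 - quadVar ν φ t ω)
      (fun r hr => hae (hdiffG φ r hr)) (fun r hr => ?_) hs hst ht hY hK
    obtain ⟨C, hC⟩ := abs_martPart_le (α := α) (T := T) (μ := ν) hφ
    obtain ⟨D, hD⟩ := abs_quadVar_le (T := T) (μ := ν) hφ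
    refine ⟨C ^ 2 + D, fun ω => (abs_sub _ _).trans (add_le_add ?_ (hD r hr ω))⟩
    rw [abs_pow]
    exact pow_le_pow_left₀ (abs_nonneg _) (hC r hr ω) 2

end Regular

section Waves

variable {d : ℕ} {f φ : EuclideanSpace ℝ (Fin d) → ℝ}

lemma abs_pairing_mul_cosWave_le (m : ProbabilityMeasure (EuclideanSpace ℝ (Fin d))) {C : ℝ}
    (hf : ∀ x, |f x| ≤ C) (i : Fin d) (k : ℝ) :
    |pairing m (fun x => f x * cosWave i k x)| ≤ C := by
  refine abs_pairing_le m fun x => ?_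
  rw [abs_mul]
  exact (mul_le_of_le_one_right (abs_nonneg _) (Real.abs_cos_le_one _)).trans (hf x)

lemma abs_pairing_mul_sinWave_le (m : ProbabilityMeasure (EuclideanSpace ℝ (Fin d))) {C : ℝ}
    (hf : ∀ x, |f x| ≤ C) (i : Fin d) (k : ℝ) :
    |pairing m (fun x => f x * sinWave i k x)| ≤ C := by
  refine abs_pairing_le m fun x => ?_
  rw [abs_mul]
  exact (mul_le_of_le_one_right (abs_nonneg _) (Real.abs_sin_le_one _)).trans (hf x)

lemma pairing_gradSq_wave (m : ProbabilityMeasure (EuclideanSpace ℝ (Fin d))) (hφ : IsTest φ)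
    (i : Fin d) (k : ℝ) :
    pairing m (gradSq fun x => φ x * cosWave i k x) + pairing m (gradSq fun x => φ x * sinWave i k x)
      = pairing m (gradSq φ) + k ^ 2 * pairing m (fun x => φ x ^ 2) := by
  rw [← pairing_add m (hφ.mul_cosWave i k).gradSq (hφ.mul_sinWave i k).gradSq]
  simp only [gradSq_mul_cosWave_add_gradSq_mul_sinWave hφ.smooth]
  rw [← pairing_const_mul]
  exact integral_add (hφ.gradSq.integrable _) ((hφ.sq.integrable _).const_mul _)

lemma pairing_laplacian_mul_cosWave (m : ProbabilityMeasure (EuclideanSpace ℝ (Fin d)))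
    (hφ : IsTest φ) (i : Fin d) (k : ℝ) :
    pairing m (laplacian fun x => φ x * cosWave i k x)
      = -k ^ 2 * pairing m (fun x => φ x * cosWave i k x)
        + (pairing m (fun x => laplacian φ x * cosWave i k x)
          - 2 * k * pairing m (fun x => pderiv i φ x * sinWave i k x)) := by
  have h1 := ((hφ.mul_cosWave i k).integrable m).const_mul (-k ^ 2)
  have h2 := (hφ.laplacian.mul_cosWave i k).integrable m
  have h3 := (((hφ.pderiv i).mul_sinWave i k).integrable m).const_mul (2 * k)
  simp only [← pairing_const_mul]
  simp only [pairing, laplacian_mul_cosWave hφ.smooth]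
  rw [← integral_sub h2 h3]
  exact integral_add h1 (h2.sub h3)

lemma pairing_laplacian_mul_sinWave (m : ProbabilityMeasure (EuclideanSpace ℝ (Fin d)))
    (hφ : IsTest φ) (i : Fin d) (k : ℝ) :
    pairing m (laplacian fun x => φ x * sinWave i k x)
      = -k ^ 2 * pairing m (fun x => φ x * sinWave i k x)
        + (pairing m (fun x => laplacian φ x * sinWave i k x)
          + 2 * k * pairing m (fun x => pderiv i φ x * cosWave i k x)) := by
  have h1 := ((hφ.mul_sinWave i k).integrable m).const_mul (-k ^ 2)
  have h2 := (hφ.laplacian.mul_sinWave i k).integrable m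
  have h3 := (((hφ.pderiv i).mul_cosWave i k).integrable m).const_mul (2 * k)
  simp only [← pairing_const_mul]
  simp only [pairing, laplacian_mul_sinWave hφ.smooth]
  rw [← integral_add h2 h3]
  exact integral_add h1 (h2.add h3)

lemma continuous_waveDefect (α : ℝ) (i : Fin d) (hφ : IsTest φ) (k : ℝ) :
    Continuous (waveDefect α i φ k) :=
  hφ.sq.continuous_pairing.sub (continuous_const.mul
    (((hφ.mul_cosWave i k).continuous_pairing.pow 2).add
      ((hφ.mul_sinWave i k).continuous_pairing.pow 2)))

lemma continuous_meanDefect (α : ℝ) (i : Fin d) (hφ : IsTest φ) (n : ℕ) :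
    Continuous (meanDefect α i φ n) :=
  continuous_const.mul (continuous_finsetSum _ fun _ _ => continuous_waveDefect α i hφ _)

lemma exists_abs_waveDefect_le (α : ℝ) (i : Fin d) (hφ : IsTest φ) :
    ∃ C, 0 ≤ C ∧ ∀ k m, |waveDefect α i φ k m| ≤ C := by
  obtain ⟨A, hA0, hA⟩ := hφ.exists_bound
  refine ⟨A ^ 2 + |α| * (A ^ 2 + A ^ 2), by positivity, fun k m => ?_⟩
  refine (abs_sub _ _).trans (add_le_add (abs_pairing_le m fun x => ?_) ?_)
  · rw [abs_pow]
    exact pow_le_pow_left₀ (abs_nonneg _) (hA x) 2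
  · rw [abs_mul]
    gcongr
    refine (abs_add_le _ _).trans (add_le_add ?_ ?_) <;> rw [abs_pow]
    · exact pow_le_pow_left₀ (abs_nonneg _) (abs_pairing_mul_cosWave_le m hA i k) 2
    · exact pow_le_pow_left₀ (abs_nonneg _) (abs_pairing_mul_sinWave_le m hA i k) 2

lemma exists_abs_meanDefect_le (α : ℝ) (i : Fin d) (hφ : IsTest φ) :
    ∃ C, 0 ≤ C ∧ ∀ n m, |meanDefect α i φ n m| ≤ C := by
  obtain ⟨C, hC0, hC⟩ := exists_abs_waveDefect_le α i hφ
  refine ⟨C, hC0, fun n m => ?_⟩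
  rcases Nat.eq_zero_or_pos n with rfl | hn
  · simpa [meanDefect] using hC0
  · have hn' : (0 : ℝ) < n := by exact_mod_cast hn
    rw [meanDefect, abs_mul, abs_of_pos (inv_pos.2 hn'), inv_mul_le_iff₀ hn']
    refine (Finset.abs_sum_le_sum_abs _ _).trans ((Finset.sum_le_sum fun j _ => hC _ m).trans ?_)
    simp

end Waves

/-- The space of real functions that are almost everywhere equal to an `m`-measurable one. -/
def aemeasurableSubmodule {Ω : Type*} (m : MeasurableSpace Ω) {mΩ : MeasurableSpace Ω}
    (P : Measure Ω) : Submodule ℝ (Ω → ℝ) where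
  carrier := {X | AEStronglyMeasurable[m] X P}
  add_mem' hX hY := AEStronglyMeasurable.add hX hY
  zero_mem' := aestronglyMeasurable_const
  smul_mem' c _ hX := AEStronglyMeasurable.const_smul hX c

namespace IsRegularSolution

variable {d : ℕ} {Ω : Type*} {mΩ : MeasurableSpace Ω} {T α : ℝ} {ℱ : Filtration ℝ mΩ}
  {P : Measure Ω} {μ : ℝ → Ω → ProbabilityMeasure (EuclideanSpace ℝ (Fin d))}
  {f φ : EuclideanSpace ℝ (Fin d) → ℝ}

lemma continuous_pairing (h : IsRegularSolution T α ℱ P μ) (hf : IsTest f) (ω : Ω) :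
    Continuous fun t => pairing (μ t ω) f :=
  hf.continuous_pairing.comp (h.cont ω)

lemma intervalIntegrable_pairing (h : IsRegularSolution T α ℱ P μ) (hf : IsTest f) (ω : Ω)
    (s t : ℝ) : IntervalIntegrable (fun r => pairing (μ r ω) f) volume s t :=
  (h.continuous_pairing hf ω).intervalIntegrable s t

/-- The variables `⟨μ_t, f⟩` are linear combinations of constants and values of martingale parts
and quadratic variations. -/
lemma pairing_mem (h : IsRegularSolution T α ℱ P μ) (i : Fin d) (S : Submodule ℝ (Ω → ℝ))
    (hconst : ∀ c : ℝ, (fun _ => c) ∈ S) {t : ℝ}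
    (hM : ∀ φ, IsTest φ → martPart α μ φ t ∈ S) (hQ : ∀ φ, IsTest φ → quadVar μ φ t ∈ S)
    (hf : IsTest f) : (fun ω => pairing (μ t ω) f) ∈ S := by
  have hsq : ∀ φ, IsTest φ → (fun ω => ∫ s in (0 : ℝ)..t, pairing (μ s ω) fun x => φ x ^ 2) ∈ S := by
    intro φ hφ
    have hc := hφ.mul_cosWave i 1
    have hs := hφ.mul_sinWave i 1
    have : (fun ω => ∫ s in (0 : ℝ)..t, pairing (μ s ω) fun x => φ x ^ 2)
        = quadVar μ (fun x => φ x * cosWave i 1 x) t + quadVar μ (fun x => φ x * sinWave i 1 x) t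
          - quadVar μ φ t := by
      funext ω
      simp only [Pi.sub_apply, Pi.add_apply, quadVar]
      rw [← intervalIntegral.integral_add (h.intervalIntegrable_pairing hc.gradSq ω _ _)
          (h.intervalIntegrable_pairing hs.gradSq ω _ _),
        ← intervalIntegral.integral_sub ((h.intervalIntegrable_pairing hc.gradSq ω _ _).add
          (h.intervalIntegrable_pairing hs.gradSq ω _ _))
          (h.intervalIntegrable_pairing hφ.gradSq ω _ _)]
      simp only [pairing_gradSq_wave _ hφ]
      congr 1
      funext s
      ring
    rw [this]
    exact S.sub_mem (S.add_mem (hQ _ hc) (hQ _ hs)) (hQ _ hφ)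
  have hinteg : ∀ g, IsTest g → (fun ω => ∫ s in (0 : ℝ)..t, pairing (μ s ω) g) ∈ S := by
    intro g hg
    obtain ⟨χ, hχ, hgχ⟩ := hg.exists_cutoff
    have hp : ∀ m : ProbabilityMeasure (EuclideanSpace ℝ (Fin d)), pairing m g
        = (1 / 2) * (pairing m (fun x => (g x + χ x) ^ 2) - pairing m (fun x => g x ^ 2)
          - pairing m (fun x => χ x ^ 2)) := by
      intro m
      have h1 := (hg.add hχ).sq.integrable m
      have h2 := hg.sq.integrable m
      have h3 := hχ.sq.integrable m
      have h12 : Integrable (fun x => (g x + χ x) ^ 2 - g x ^ 2)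
        (m : Measure (EuclideanSpace ℝ (Fin d))) := h1.sub h2
      simp only [pairing]
      rw [← integral_sub h1 h2, ← integral_sub h12 h3, ← integral_const_mul]
      congr 1
      funext x
      linear_combination - hgχ x
    have : (fun ω => ∫ s in (0 : ℝ)..t, pairing (μ s ω) g)
        = (1 / 2 : ℝ) • ((fun ω => ∫ s in (0 : ℝ)..t, pairing (μ s ω) fun x => (g x + χ x) ^ 2)
          - (fun ω => ∫ s in (0 : ℝ)..t, pairing (μ s ω) fun x => g x ^ 2)
          - fun ω => ∫ s in (0 : ℝ)..t, pairing (μ s ω) fun x => χ x ^ 2) := by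
      funext ω
      have h1 := h.intervalIntegrable_pairing (hg.add hχ).sq ω 0 t
      have h2 := h.intervalIntegrable_pairing hg.sq ω 0 t
      have h3 := h.intervalIntegrable_pairing hχ.sq ω 0 t
      simp only [Pi.smul_apply, Pi.sub_apply, smul_eq_mul]
      rw [← intervalIntegral.integral_sub h1 h2, ← intervalIntegral.integral_sub (h1.sub h2) h3,
        ← intervalIntegral.integral_const_mul]
      simp only [← hp]
    rw [this]
    exact S.smul_mem _ (S.sub_mem (S.sub_mem (hsq _ (hg.add hχ)) (hsq _ hg)) (hsq _ hχ))
  obtain ⟨μ0, h0⟩ := h.init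
  have : (fun ω => pairing (μ t ω) f) = martPart α μ f t + (fun _ => pairing μ0 f)
      + (α / 2) • fun ω => ∫ s in (0 : ℝ)..t, pairing (μ s ω) (laplacian f) := by
    funext ω
    simp only [Pi.add_apply, Pi.smul_apply, smul_eq_mul, martPart, h0]
    ring
  rw [this]
  exact S.add_mem (S.add_mem (hM f hf) (hconst _)) (S.smul_mem _ (hinteg _ hf.laplacian))

lemma measurable_pairing (h : IsRegularSolution T α ℱ P μ) (i : Fin d) (hf : IsTest f) (t : ℝ) :
    Measurable fun ω => pairing (μ t ω) f := by
  obtain ⟨s, hs, hts⟩ := h.clamp t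
  rw [hts]
  let S : Submodule ℝ (Ω → ℝ) :=
    { carrier := {X | Measurable X}
      add_mem' := fun hX hY => Measurable.add hX hY
      zero_mem' := measurable_const
      smul_mem' := fun c _ hX => Measurable.const_smul hX c }
  exact h.pairing_mem i S (fun _ => measurable_const) (fun φ hφ => h.meas_martPart φ hφ s hs)
    (fun φ hφ => h.meas_quadVar φ hφ s hs) hf

lemma adapted_pairing (h : IsRegularSolution T α ℱ P μ) (i : Fin d) (hf : IsTest f) {t : ℝ}
    (ht : t ∈ Icc 0 T) : AEStronglyMeasurable[ℱ t] (fun ω => pairing (μ t ω) f) P :=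
  h.pairing_mem i (aemeasurableSubmodule (ℱ t) P) (fun _ => aestronglyMeasurable_const)
    (fun φ hφ => h.adapted_martPart φ hφ t ht) (fun φ hφ => h.adapted_quadVar φ hφ t ht) hf

lemma measurable_waveDefect (h : IsRegularSolution T α ℱ P μ) (i : Fin d) (hφ : IsTest φ) (k t : ℝ) :
    Measurable fun ω => waveDefect α i φ k (μ t ω) :=
  (h.measurable_pairing i hφ.sq t).sub
    ((((h.measurable_pairing i (hφ.mul_cosWave i k) t).pow_const 2).add
      ((h.measurable_pairing i (hφ.mul_sinWave i k) t).pow_const 2)).const_mul α)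

lemma measurable_meanDefect (h : IsRegularSolution T α ℱ P μ) (i : Fin d) (hφ : IsTest φ) (n : ℕ)
    (t : ℝ) : Measurable fun ω => meanDefect α i φ n (μ t ω) :=
  (Finset.measurable_fun_sum _ fun _ _ => h.measurable_waveDefect i hφ _ t).const_mul _

lemma adapted_meanDefect (h : IsRegularSolution T α ℱ P μ) (i : Fin d) (hφ : IsTest φ) (n : ℕ)
    {t : ℝ} (ht : t ∈ Icc 0 T) :
    AEStronglyMeasurable[ℱ t] (fun ω => meanDefect α i φ n (μ t ω)) P := by
  have hw : ∀ k, (fun ω => waveDefect α i φ k (μ t ω)) ∈ aemeasurableSubmodule (ℱ t) P := fun k =>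
    (h.adapted_pairing i hφ.sq ht).sub
      ((((h.adapted_pairing i (hφ.mul_cosWave i k) ht).pow 2).add
        ((h.adapted_pairing i (hφ.mul_sinWave i k) ht).pow 2)).const_mul α)
  have : (fun ω => meanDefect α i φ n (μ t ω)) = (n : ℝ)⁻¹ •
      ∑ j ∈ Finset.range n, fun ω => waveDefect α i φ (j + 1 : ℕ) (μ t ω) := by
    funext ω
    simp [meanDefect]
  rw [this]
  exact Submodule.smul_mem _ _ (Submodule.sum_mem _ fun j _ => hw _)

end IsRegularSolution

lemma hasDerivAt_intervalIntegral_of_continuous {g : ℝ → ℝ} (hg : Continuous g) (a r : ℝ) :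
    HasDerivAt (fun u => ∫ x in a..u, g x) (g r) r :=
  intervalIntegral.integral_hasDerivAt_right (hg.intervalIntegrable _ _)
    (hg.stronglyMeasurableAtFilter _ _) hg.continuousAt

namespace IsRegularSolution

variable {d : ℕ} {Ω : Type*} {mΩ : MeasurableSpace Ω} {T α : ℝ} {ℱ : Filtration ℝ mΩ}
  {P : Measure Ω} {μ : ℝ → Ω → ProbabilityMeasure (EuclideanSpace ℝ (Fin d))}
  {f φ : EuclideanSpace ℝ (Fin d) → ℝ}

lemma measurable_martPart (h : IsRegularSolution T α ℱ P μ) (i : Fin d) (hφ : IsTest φ) (t : ℝ) :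
    Measurable (martPart α μ φ t) :=
  ((h.measurable_pairing i hφ t).sub (h.measurable_pairing i hφ 0)).sub
    ((measurable_intervalIntegral_of_continuous (h.continuous_pairing hφ.laplacian)
      (h.measurable_pairing i hφ.laplacian) 0 t).const_mul _)

lemma continuous_martPart (h : IsRegularSolution T α ℱ P μ) (hφ : IsTest φ) (ω : Ω) :
    Continuous fun t => martPart α μ φ t ω :=
  ((h.continuous_pairing hφ ω).sub continuous_const).sub (continuous_const.mul
    (intervalIntegral.continuous_primitive (h.intervalIntegrable_pairing hφ.laplacian ω) 0))

/-- The remainder in Itô's formula for `⟨μ_t, φ⟩²`. -/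
def itoRemainder (α : ℝ) (μ : ℝ → Ω → ProbabilityMeasure (EuclideanSpace ℝ (Fin d)))
    (φ : EuclideanSpace ℝ (Fin d) → ℝ) (s t : ℝ) (ω : Ω) : ℝ :=
  pairing (μ t ω) φ ^ 2 - pairing (μ s ω) φ ^ 2
    - ∫ r in s..t, (α * (pairing (μ r ω) φ * pairing (μ r ω) (laplacian φ))
      + pairing (μ r ω) (gradSq φ))

lemma itoRemainder_eq (h : IsRegularSolution T α ℱ P μ) (hφ : IsTest φ) (s t : ℝ) (ω : Ω) :
    itoRemainder α μ φ s t ω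
      = (martPart α μ φ t ω ^ 2 - quadVar μ φ t ω - (martPart α μ φ s ω ^ 2 - quadVar μ φ s ω))
        + 2 * ((pairing (μ s ω) φ - martPart α μ φ s ω) * (martPart α μ φ t ω - martPart α μ φ s ω))
        + α * ∫ r in s..t, pairing (μ r ω) (laplacian φ)
          * (martPart α μ φ t ω - martPart α μ φ r ω) := by
  have hM := h.continuous_martPart hφ ω
  have ha := h.continuous_pairing hφ ω
  have hb := h.continuous_pairing hφ.laplacian ω
  have hq := h.continuous_pairing hφ.gradSq ω
  have hderiv : ∀ r, HasDerivAt (fun r => pairing (μ r ω) φ - martPart α μ φ r ω)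
      (α / 2 * pairing (μ r ω) (laplacian φ)) r := by
    intro r
    have h1 := ((hasDerivAt_intervalIntegral_of_continuous hb 0 r).const_mul (α / 2)).const_add
      (pairing (μ 0 ω) φ)
    refine h1.congr_of_eventuallyEq (Eventually.of_forall fun u => ?_)
    simp only [martPart]
    ring
  have hC : (∫ r in s..t, α / 2 * pairing (μ r ω) (laplacian φ))
      = (pairing (μ t ω) φ - martPart α μ φ t ω) - (pairing (μ s ω) φ - martPart α μ φ s ω) :=
    intervalIntegral.integral_eq_sub_of_hasDerivAt (fun r _ => hderiv r)
      ((continuous_const.mul hb).intervalIntegrable _ _)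
  have hC2 : (∫ r in s..t, α * ((pairing (μ r ω) φ - martPart α μ φ r ω)
        * pairing (μ r ω) (laplacian φ)))
      = (pairing (μ t ω) φ - martPart α μ φ t ω) ^ 2
        - (pairing (μ s ω) φ - martPart α μ φ s ω) ^ 2 := by
    refine intervalIntegral.integral_eq_sub_of_hasDerivAt
      (f := fun r => (pairing (μ r ω) φ - martPart α μ φ r ω) ^ 2) (fun r _ => ?_)
      (Continuous.intervalIntegrable (by fun_prop) _ _)
    refine ((hderiv r).fun_pow 2).congr_deriv ?_
    push_cast
    ring
  have hQ : quadVar μ φ t ω - quadVar μ φ s ω = ∫ r in s..t, pairing (μ r ω) (gradSq φ) :=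
    intervalIntegral.integral_interval_sub_left (hq.intervalIntegrable _ _)
      (hq.intervalIntegrable _ _)
  have hsplit1 : (∫ r in s..t, (α * (pairing (μ r ω) φ * pairing (μ r ω) (laplacian φ))
        + pairing (μ r ω) (gradSq φ)))
      = (∫ r in s..t, α * ((pairing (μ r ω) φ - martPart α μ φ r ω)
        * pairing (μ r ω) (laplacian φ)))
        + α * (∫ r in s..t, pairing (μ r ω) (laplacian φ) * martPart α μ φ r ω)
        + ∫ r in s..t, pairing (μ r ω) (gradSq φ) := by
    rw [← intervalIntegral.integral_const_mul, ← intervalIntegral.integral_add,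
      ← intervalIntegral.integral_add]
    · congr 1
      funext r
      ring
    all_goals exact Continuous.intervalIntegrable (by fun_prop) _ _
  have hsplit2 : α * (∫ r in s..t, pairing (μ r ω) (laplacian φ)
          * (martPart α μ φ t ω - martPart α μ φ r ω))
      = 2 * (martPart α μ φ t ω * ∫ r in s..t, α / 2 * pairing (μ r ω) (laplacian φ))
        - α * ∫ r in s..t, pairing (μ r ω) (laplacian φ) * martPart α μ φ r ω := by
    rw [← intervalIntegral.integral_const_mul, ← intervalIntegral.integral_const_mul,
      ← intervalIntegral.integral_const_mul, ← intervalIntegral.integral_const_mul,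
      ← intervalIntegral.integral_sub]
    · congr 1
      funext r
      ring
    all_goals exact Continuous.intervalIntegrable (by fun_prop) _ _
  rw [itoRemainder, hsplit1, hsplit2, hC, hC2, ← hQ]
  ring

variable [IsProbabilityMeasure P]

lemma integrable_and_integral_mul_itoRemainder (h : IsRegularSolution T α ℱ P μ) (i : Fin d)
    (hφ : IsTest φ) {s t : ℝ} (hs : 0 ≤ s) (hst : s ≤ t) (ht : t ≤ T) {Y : Ω → ℝ} {K : ℝ}
    (hY : AEStronglyMeasurable[ℱ s] Y P) (hK : ∀ ω, |Y ω| ≤ K) :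
    Integrable (fun ω => Y ω * itoRemainder α μ φ s t ω) P
      ∧ ∫ ω, Y ω * itoRemainder α μ φ s t ω ∂P = 0 := by
  have hsI : s ∈ Icc 0 T := ⟨hs, hst.trans ht⟩
  have htI : t ∈ Icc 0 T := ⟨hs.trans hst, ht⟩
  have hYm : AEStronglyMeasurable Y P := hY.mono (ℱ.le s)
  obtain ⟨A, hA0, hA⟩ := hφ.exists_bound
  obtain ⟨B, hB0, hB⟩ := hφ.laplacian.exists_bound
  obtain ⟨C, hC⟩ := abs_martPart_le (α := α) (T := T) (μ := μ) hφ
  obtain ⟨D, hD⟩ := abs_quadVar_le (T := T) (μ := μ) hφ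
  have hMm := h.measurable_martPart i hφ
  have hMb : ∀ r ∈ Icc 0 T, Integrable (fun ω => martPart α μ φ t ω - martPart α μ φ r ω) P :=
    fun r hr => integrable_of_abs_le ((hMm t).sub (hMm r)).aestronglyMeasurable
      fun ω => (abs_sub _ _).trans (add_le_add (hC t htI ω) (hC r hr ω))
  have hNb : ∀ r ∈ Icc 0 T, Integrable (fun ω => martPart α μ φ r ω ^ 2 - quadVar μ φ r ω) P := by
    refine fun r hr => Integrable.sub (integrable_of_abs_le
      ((hMm r).pow_const 2).aestronglyMeasurable (C := C ^ 2) fun ω => ?_)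
      (integrable_of_abs_le (h.meas_quadVar φ hφ r hr).aestronglyMeasurable (hD r hr))
    rw [abs_pow]
    exact pow_le_pow_left₀ (abs_nonneg _) (hC r hr ω) 2
  have h1 := h.orth_sq φ hφ s t hs hst ht Y K hY hK
  have i1 := ((hNb t htI).sub (hNb s hsI)).bdd_mul hYm (ae_of_all _ hK)
  have hYC : AEStronglyMeasurable[ℱ s]
      (fun ω => Y ω * (pairing (μ s ω) φ - martPart α μ φ s ω)) P :=
    hY.mul ((h.adapted_pairing i hφ hsI).sub (h.adapted_martPart φ hφ s hsI))
  have hYCb : ∀ ω, |Y ω * (pairing (μ s ω) φ - martPart α μ φ s ω)| ≤ K * (A + C) := fun ω => by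
    rw [abs_mul]
    exact mul_le_mul (hK ω) ((abs_sub _ _).trans (add_le_add (abs_pairing_le _ hA) (hC s hsI ω)))
      (abs_nonneg _) ((abs_nonneg _).trans (hK ω))
  have h2 := h.orth φ hφ s t hs hst ht _ _ hYC hYCb
  have i2 := (hMb s hsI).bdd_mul (hYC.mono (ℱ.le s)) (ae_of_all _ hYCb)
  have hXc : ∀ ω, Continuous fun r => pairing (μ r ω) (laplacian φ)
      * (martPart α μ φ t ω - martPart α μ φ r ω) := fun ω =>
    (h.continuous_pairing hφ.laplacian ω).mul
      (continuous_const.sub (h.continuous_martPart hφ ω))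
  have hXm : ∀ r, Measurable fun ω => pairing (μ r ω) (laplacian φ)
      * (martPart α μ φ t ω - martPart α μ φ r ω) := fun r =>
    (h.measurable_pairing i hφ.laplacian r).mul ((hMm t).sub (hMm r))
  have hXb : ∀ r ∈ Icc s t, ∀ ω, |pairing (μ r ω) (laplacian φ)
      * (martPart α μ φ t ω - martPart α μ φ r ω)| ≤ B * (C + C) := fun r hr ω => by
    rw [abs_mul]
    exact mul_le_mul (abs_pairing_le _ hB) ((abs_sub _ _).trans
      (add_le_add (hC t htI ω) (hC r ⟨hs.trans hr.1, hr.2.trans ht⟩ ω))) (abs_nonneg _) hB0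
  have h3 : ∫ ω, Y ω * (∫ r in s..t, pairing (μ r ω) (laplacian φ)
      * (martPart α μ φ t ω - martPart α μ φ r ω)) ∂P = 0 := by
    rw [integral_mul_intervalIntegral_swap hXc hXm hst hXb hYm hK]
    refine (intervalIntegral.integral_congr fun r hr => ?_).trans intervalIntegral.integral_zero
    rw [uIcc_of_le hst] at hr
    have hrI : r ∈ Icc 0 T := ⟨hs.trans hr.1, hr.2.trans ht⟩
    simp only [← mul_assoc]
    refine h.orth φ hφ r t hrI.1 hr.2 ht _ (K * B)
      ((hY.mono (ℱ.mono hr.1)).mul (h.adapted_pairing i hφ.laplacian hrI)) fun ω => ?_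
    rw [abs_mul]
    exact mul_le_mul (hK ω) (abs_pairing_le _ hB) (abs_nonneg _) ((abs_nonneg _).trans (hK ω))
  have i3 := (integrable_of_abs_le (P := P)
    (measurable_intervalIntegral_of_continuous hXc hXm s t).aestronglyMeasurable
    fun ω => abs_intervalIntegral_le hst fun r hr => hXb r hr ω).bdd_mul hYm (ae_of_all _ hK)
  have heq : (fun ω => Y ω * itoRemainder α μ φ s t ω) = fun ω =>
      Y ω * (martPart α μ φ t ω ^ 2 - quadVar μ φ t ω - (martPart α μ φ s ω ^ 2 - quadVar μ φ s ω))
      + 2 * (Y ω * (pairing (μ s ω) φ - martPart α μ φ s ω)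
        * (martPart α μ φ t ω - martPart α μ φ s ω))
      + α * (Y ω * ∫ r in s..t, pairing (μ r ω) (laplacian φ)
          * (martPart α μ φ t ω - martPart α μ φ r ω)) := by
    funext ω
    rw [h.itoRemainder_eq hφ]
    ring
  have i12 := i1.add (i2.const_mul 2)
  have i33 := i3.const_mul α
  constructor
  · rw [heq]
    exact i12.add i33
  · rw [heq]
    refine (integral_add i12 i33).trans ?_
    refine (congrArg₂ (· + ·) (integral_add i1 (i2.const_mul 2)) rfl).trans ?_
    simp only [integral_const_mul, Pi.sub_apply, h1, h2, h3]
    simp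

end IsRegularSolution

/-- The second moment of the time integral of a process is controlled by its correlation with its
own future. -/
lemma integral_sq_intervalIntegral_le {Ω : Type*} {mΩ : MeasurableSpace Ω} {P : Measure Ω}
    [IsProbabilityMeasure P] {X : ℝ → Ω → ℝ} (hc : ∀ ω, Continuous fun t => X t ω)
    (hm : ∀ t, Measurable (X t)) {C : ℝ} (hC : ∀ t ω, |X t ω| ≤ C) {t ε : ℝ} (ht : 0 ≤ t)
    (hε : ∀ s ∈ Icc 0 t, |∫ ω, X s ω * (∫ r in s..t, X r ω) ∂P| ≤ ε) :
    ∫ ω, (∫ r in (0 : ℝ)..t, X r ω) ^ 2 ∂P ≤ 2 * ε * t := by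
  have hsub : ∀ s ω, ∫ r in s..t, X r ω = (∫ r in (0 : ℝ)..t, X r ω) - ∫ r in (0 : ℝ)..s, X r ω :=
    fun s ω => (intervalIntegral.integral_interval_sub_left ((hc ω).intervalIntegrable _ _)
      ((hc ω).intervalIntegrable _ _)).symm
  have hcU : ∀ ω, Continuous fun s => ∫ r in s..t, X r ω := fun ω => by
    rw [funext fun s => hsub s ω]
    exact continuous_const.sub
      (intervalIntegral.continuous_primitive (fun a b => (hc ω).intervalIntegrable a b) 0)
  have hsq : ∀ ω, (∫ r in (0 : ℝ)..t, X r ω) ^ 2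
      = 1 * ∫ s in (0 : ℝ)..t, 2 * (X s ω * ∫ r in s..t, X r ω) := by
    intro ω
    have := hc ω
    have := hcU ω
    rw [intervalIntegral.integral_eq_sub_of_hasDerivAt
      (f := fun s => -(∫ r in s..t, X r ω) ^ 2)
      (f' := fun s => 2 * (X s ω * ∫ r in s..t, X r ω)) (fun s _ => ?_)
      (Continuous.intervalIntegrable (by fun_prop) _ _)]
    · simp
    · have h1 := (((hasDerivAt_intervalIntegral_of_continuous (hc ω) 0 s).const_sub
        (∫ r in (0 : ℝ)..t, X r ω)).fun_pow 2).fun_neg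
      simp only [← hsub] at h1
      refine h1.congr_deriv ?_
      push_cast
      ring
  have hC0 : ∀ ω, 0 ≤ C := fun ω => (abs_nonneg _).trans (hC 0 ω)
  simp only [hsq]
  rw [integral_mul_intervalIntegral_swap (X := fun s ω => 2 * (X s ω * ∫ r in s..t, X r ω))
    (Y := fun _ => 1) (C := 2 * (C * (C * (t - 0)))) (K := 1)
    (fun ω => continuous_const.mul ((hc ω).mul (hcU ω)))
    (fun s => ((hm s).mul (measurable_intervalIntegral_of_continuous hc hm s t)).const_mul 2) ht
    (fun s hs ω => ?_) aestronglyMeasurable_const (by simp)]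
  · refine (le_abs_self _).trans ((abs_intervalIntegral_le (C := 2 * ε) ht fun s hs => ?_).trans_eq
      (by ring))
    simp only [one_mul, integral_const_mul, abs_mul, abs_two]
    exact mul_le_mul_of_nonneg_left (hε s hs) zero_le_two
  · rw [abs_mul, abs_mul, abs_two]
    refine mul_le_mul_of_nonneg_left (mul_le_mul (hC s ω) ?_ (abs_nonneg _) (hC0 ω)) zero_le_two
    refine (abs_intervalIntegral_le hs.2 fun r _ => hC r ω).trans ?_
    exact mul_le_mul_of_nonneg_left (by linarith [hs.1]) (hC0 ω)

namespace IsRegularSolution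

variable {d : ℕ} {Ω : Type*} {mΩ : MeasurableSpace Ω} {T α : ℝ} {ℱ : Filtration ℝ mΩ}
  {P : Measure Ω} {μ : ℝ → Ω → ProbabilityMeasure (EuclideanSpace ℝ (Fin d))}
  {φ : EuclideanSpace ℝ (Fin d) → ℝ}

lemma continuous_waveDefect_comp (h : IsRegularSolution T α ℱ P μ) (i : Fin d) (hφ : IsTest φ)
    (k : ℝ) (ω : Ω) : Continuous fun t => waveDefect α i φ k (μ t ω) :=
  (continuous_waveDefect α i hφ k).comp (h.cont ω)

lemma continuous_meanDefect_comp (h : IsRegularSolution T α ℱ P μ) (i : Fin d) (hφ : IsTest φ)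
    (n : ℕ) (ω : Ω) : Continuous fun t => meanDefect α i φ n (μ t ω) :=
  (continuous_meanDefect α i hφ n).comp (h.cont ω)

lemma sq_mul_intervalIntegral_waveDefect (h : IsRegularSolution T α ℱ P μ) (i : Fin d)
    (hφ : IsTest φ) : ∃ C, 0 ≤ C ∧ ∀ k, 1 ≤ k → ∀ s t, 0 ≤ s → s ≤ t → t ≤ T → ∀ ω,
      |k ^ 2 * (∫ r in s..t, waveDefect α i φ k (μ r ω))
        + (itoRemainder α μ (fun x => φ x * cosWave i k x) s t ω
          + itoRemainder α μ (fun x => φ x * sinWave i k x) s t ω)| ≤ C * k := by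
  obtain ⟨A, hA0, hA⟩ := hφ.exists_bound
  obtain ⟨L, hL0, hL⟩ := hφ.laplacian.exists_bound
  obtain ⟨D, hD0, hD⟩ := (hφ.pderiv i).exists_bound
  obtain ⟨G, hG0, hG⟩ := hφ.gradSq.exists_bound
  rcases lt_or_ge T 0 with hT | hT
  · exact ⟨0, le_rfl, fun k _ s t hs hst ht => absurd (hs.trans (hst.trans ht)) (not_le.2 hT)⟩
  set R := G + |α| * (A * (L + 2 * D) + A * (L + 2 * D)) with hR
  have hR0 : 0 ≤ R := by positivity
  refine ⟨4 * A ^ 2 + R * T, by positivity, fun k hk s t hs hst ht ω => ?_⟩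
  have hk0 : 0 ≤ k := zero_le_one.trans hk
  have hc := hφ.mul_cosWave i k
  have hs' := hφ.mul_sinWave i k
  have c1 := h.continuous_pairing hc ω
  have c2 := h.continuous_pairing hs' ω
  have c3 := h.continuous_pairing hc.laplacian ω
  have c4 := h.continuous_pairing hs'.laplacian ω
  have c5 := h.continuous_pairing hc.gradSq ω
  have c6 := h.continuous_pairing hs'.gradSq ω
  have c7 := h.continuous_pairing (hφ.laplacian.mul_cosWave i k) ω
  have c8 := h.continuous_pairing (hφ.laplacian.mul_sinWave i k) ω
  have c9 := h.continuous_pairing ((hφ.pderiv i).mul_cosWave i k) ω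
  have c10 := h.continuous_pairing ((hφ.pderiv i).mul_sinWave i k) ω
  have c11 := h.continuous_pairing hφ.gradSq ω
  have c12 := h.continuous_waveDefect_comp i hφ k ω
  let W : ℝ → ℝ := fun r => pairing (μ r ω) (gradSq φ)
    + α * (pairing (μ r ω) (fun x => φ x * cosWave i k x)
        * (pairing (μ r ω) (fun x => laplacian φ x * cosWave i k x)
          - 2 * k * pairing (μ r ω) (fun x => pderiv i φ x * sinWave i k x))
      + pairing (μ r ω) (fun x => φ x * sinWave i k x)
        * (pairing (μ r ω) (fun x => laplacian φ x * sinWave i k x)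
          + 2 * k * pairing (μ r ω) (fun x => pderiv i φ x * cosWave i k x)))
  have hsum : (∫ r in s..t, (α * (pairing (μ r ω) (fun x => φ x * cosWave i k x)
          * pairing (μ r ω) (laplacian fun x => φ x * cosWave i k x))
        + pairing (μ r ω) (gradSq fun x => φ x * cosWave i k x)))
      + (∫ r in s..t, (α * (pairing (μ r ω) (fun x => φ x * sinWave i k x)
          * pairing (μ r ω) (laplacian fun x => φ x * sinWave i k x))
        + pairing (μ r ω) (gradSq fun x => φ x * sinWave i k x)))
      = k ^ 2 * (∫ r in s..t, waveDefect α i φ k (μ r ω)) + ∫ r in s..t, W r := by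
    rw [← intervalIntegral.integral_const_mul, ← intervalIntegral.integral_add,
      ← intervalIntegral.integral_add]
    · congr 1
      funext r
      simp only [W, waveDefect, pairing_laplacian_mul_cosWave _ hφ,
        pairing_laplacian_mul_sinWave _ hφ]
      linear_combination pairing_gradSq_wave (μ r ω) hφ i k
    all_goals exact Continuous.intervalIntegrable (by fun_prop) _ _
  have hW : ∀ r ∈ Icc s t, |W r| ≤ R * k := by
    intro r _
    have key : ∀ a b c : ℝ, |a| ≤ A → |b| ≤ L → |c| ≤ D → |a * (b + 2 * k * c)| ≤
        A * (L + 2 * D) * k := by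
      intro a b c ha hb hc
      rw [abs_mul, mul_assoc A]
      refine mul_le_mul ha ((abs_add_le _ _).trans ?_) (abs_nonneg _) hA0
      rw [abs_mul, abs_mul, abs_two, abs_of_nonneg hk0, add_mul]
      refine add_le_add (hb.trans (le_mul_of_one_le_right hL0 hk)) ?_
      nlinarith
    refine (abs_add_le _ _).trans ?_
    rw [hR, add_mul, mul_assoc |α|, add_mul (A * (L + 2 * D)), abs_mul]
    refine add_le_add ((abs_pairing_le _ hG).trans (le_mul_of_one_le_right hG0 hk))
      (mul_le_mul_of_nonneg_left ((abs_add_le _ _).trans (add_le_add ?_ ?_)) (abs_nonneg _))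
    · rw [sub_eq_add_neg, ← mul_neg]
      refine key _ _ _ (abs_pairing_mul_cosWave_le _ hA i k)
        (abs_pairing_mul_cosWave_le _ hL i k) ?_
      rw [abs_neg]
      exact abs_pairing_mul_sinWave_le _ hD i k
    · exact key _ _ _ (abs_pairing_mul_sinWave_le _ hA i k)
        (abs_pairing_mul_sinWave_le _ hL i k) (abs_pairing_mul_cosWave_le _ hD i k)
  have hWint := abs_intervalIntegral_le hst hW
  have hWT : R * k * (t - s) ≤ R * T * k := by
    rw [mul_right_comm]
    exact mul_le_mul_of_nonneg_right (mul_le_mul_of_nonneg_left (by linarith) hR0) hk0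
  have hsqb : ∀ {a : ℝ}, |a| ≤ A → a ^ 2 ≤ A ^ 2 := fun ha => sq_le_sq' (abs_le.1 ha).1 (abs_le.1 ha).2
  have q1 := hsqb (abs_pairing_mul_cosWave_le (μ t ω) hA i k)
  have q2 := hsqb (abs_pairing_mul_cosWave_le (μ s ω) hA i k)
  have q3 := hsqb (abs_pairing_mul_sinWave_le (μ t ω) hA i k)
  have q4 := hsqb (abs_pairing_mul_sinWave_le (μ s ω) hA i k)
  have p1 := sq_nonneg (pairing (μ t ω) fun x => φ x * cosWave i k x)
  have p2 := sq_nonneg (pairing (μ s ω) fun x => φ x * cosWave i k x)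
  have p3 := sq_nonneg (pairing (μ t ω) fun x => φ x * sinWave i k x)
  have p4 := sq_nonneg (pairing (μ s ω) fun x => φ x * sinWave i k x)
  have hA2 : A ^ 2 ≤ A ^ 2 * k := le_mul_of_one_le_right (sq_nonneg A) hk
  have hWint' := abs_le.1 (hWint.trans hWT)
  simp only [itoRemainder]
  rw [abs_le]
  constructor <;> nlinarith [hsum, hWint'.1, hWint'.2]

variable [IsProbabilityMeasure P]

lemma integrable_mul_intervalIntegral_waveDefect (h : IsRegularSolution T α ℱ P μ) (i : Fin d)
    (hφ : IsTest φ) (k : ℝ) {s t : ℝ} (hst : s ≤ t) {Y : Ω → ℝ} {K : ℝ}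
    (hY : AEStronglyMeasurable Y P) (hK : ∀ ω, |Y ω| ≤ K) :
    Integrable (fun ω => Y ω * ∫ r in s..t, waveDefect α i φ k (μ r ω)) P := by
  obtain ⟨B, -, hB⟩ := exists_abs_waveDefect_le α i hφ
  exact (integrable_of_abs_le (measurable_intervalIntegral_of_continuous
    (h.continuous_waveDefect_comp i hφ k) (h.measurable_waveDefect i hφ k) s t).aestronglyMeasurable
    fun ω => abs_intervalIntegral_le hst fun r _ => hB k _).bdd_mul hY (ae_of_all _ hK)

lemma exists_abs_integral_mul_waveDefect_le (h : IsRegularSolution T α ℱ P μ) (i : Fin d)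
    (hφ : IsTest φ) : ∃ C, 0 ≤ C ∧ ∀ k, 1 ≤ k → ∀ s t, 0 ≤ s → s ≤ t → t ≤ T →
      ∀ (Y : Ω → ℝ) (K : ℝ), AEStronglyMeasurable[ℱ s] Y P → (∀ ω, |Y ω| ≤ K) →
      |∫ ω, Y ω * (∫ r in s..t, waveDefect α i φ k (μ r ω)) ∂P| ≤ K * C * (1 / k) := by
  obtain ⟨C, hC0, hC⟩ := h.sq_mul_intervalIntegral_waveDefect i hφ
  refine ⟨C, hC0, fun k hk s t hs hst ht Y K hY hK => ?_⟩
  have hk0 : 0 < k := zero_lt_one.trans_le hk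
  obtain ⟨i1, e1⟩ := h.integrable_and_integral_mul_itoRemainder i (hφ.mul_cosWave i k) hs hst ht
    hY hK
  obtain ⟨i2, e2⟩ := h.integrable_and_integral_mul_itoRemainder i (hφ.mul_sinWave i k) hs hst ht
    hY hK
  have i3 := h.integrable_mul_intervalIntegral_waveDefect i hφ k hst (hY.mono (ℱ.le s)) hK
  have hle := abs_integral_le_of_abs_le (P := P) (C := K * (C * k)) fun ω => (by
    rw [abs_mul]
    exact mul_le_mul (hK ω) (hC k hk s t hs hst ht ω) (abs_nonneg _)
      ((abs_nonneg _).trans (hK ω)) : |Y ω * _| ≤ _)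
  have heq : ∫ ω, Y ω * (k ^ 2 * (∫ r in s..t, waveDefect α i φ k (μ r ω))
        + (itoRemainder α μ (fun x => φ x * cosWave i k x) s t ω
          + itoRemainder α μ (fun x => φ x * sinWave i k x) s t ω)) ∂P
      = k ^ 2 * ∫ ω, Y ω * (∫ r in s..t, waveDefect α i φ k (μ r ω)) ∂P := by
    simp only [mul_add, mul_left_comm (Y _) (k ^ 2)]
    refine (integral_add (i3.const_mul _) (i1.add i2)).trans ?_
    rw [integral_add' i1 i2, e1, e2, integral_const_mul, add_zero, add_zero]
  rw [heq, abs_mul, abs_of_nonneg (sq_nonneg k)] at hle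
  rw [mul_one_div, le_div_iff₀ hk0]
  refine le_of_mul_le_mul_right ?_ hk0
  linarith

lemma exists_abs_integral_mul_meanDefect_le (h : IsRegularSolution T α ℱ P μ) (i : Fin d)
    (hφ : IsTest φ) : ∃ C, 0 ≤ C ∧ ∀ n s t, 0 ≤ s → s ≤ t → t ≤ T →
      ∀ (Y : Ω → ℝ) (K : ℝ), AEStronglyMeasurable[ℱ s] Y P → (∀ ω, |Y ω| ≤ K) →
      |∫ ω, Y ω * (∫ r in s..t, meanDefect α i φ n (μ r ω)) ∂P|
        ≤ K * C * ((n : ℝ)⁻¹ * ∑ j ∈ Finset.range n, 1 / ((j : ℝ) + 1)) := by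
  obtain ⟨C, hC0, hC⟩ := h.exists_abs_integral_mul_waveDefect_le i hφ
  refine ⟨C, hC0, fun n s t hs hst ht Y K hY hK => ?_⟩
  have heq : ∫ ω, Y ω * (∫ r in s..t, meanDefect α i φ n (μ r ω)) ∂P = (n : ℝ)⁻¹ *
      ∑ j ∈ Finset.range n, ∫ ω, Y ω * (∫ r in s..t, waveDefect α i φ (j + 1 : ℕ) (μ r ω)) ∂P := by
    rw [← integral_finsetSum _ fun j _ => h.integrable_mul_intervalIntegral_waveDefect i hφ _ hst
      (hY.mono (ℱ.le s)) hK, ← integral_const_mul]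
    congr 1
    funext ω
    simp only [meanDefect]
    rw [intervalIntegral.integral_const_mul, intervalIntegral.integral_finsetSum fun j _ =>
      (h.continuous_waveDefect_comp i hφ _ ω).intervalIntegrable _ _, ← Finset.mul_sum]
    ring
  rw [heq, abs_mul, abs_of_nonneg (by positivity : (0 : ℝ) ≤ (n : ℝ)⁻¹), mul_left_comm,
    Finset.mul_sum]
  refine mul_le_mul_of_nonneg_left ((Finset.abs_sum_le_sum_abs _ _).trans
    (Finset.sum_le_sum fun j _ => ?_)) (by positivity)
  have := hC (j + 1 : ℕ) (by simp) s t hs hst ht Y K hY hK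
  simpa only [Nat.cast_add, Nat.cast_one] using this

end IsRegularSolution

namespace IsRegularSolution

variable {d : ℕ} {Ω : Type*} {mΩ : MeasurableSpace Ω} {T α : ℝ} {ℱ : Filtration ℝ mΩ}
  {P : Measure Ω} {μ : ℝ → Ω → ProbabilityMeasure (EuclideanSpace ℝ (Fin d))}
  {φ : EuclideanSpace ℝ (Fin d) → ℝ}

lemma locallyIntegrable_limitDefect (h : IsRegularSolution T α ℱ P μ) (i : Fin d) (hφ : IsTest φ)
    (ω : Ω) : LocallyIntegrable (fun r => limitDefect α i φ (μ r ω)) volume := by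
  obtain ⟨B, -, hB⟩ := exists_abs_meanDefect_le α i hφ
  have hlim : ∀ r, Tendsto (fun n => meanDefect α i φ n (μ r ω)) atTop
      (𝓝 (limitDefect α i φ (μ r ω))) := fun r => tendsto_meanDefect α i hφ _
  have hmeas : Measurable fun r => limitDefect α i φ (μ r ω) :=
    measurable_of_tendsto_metrizable (fun n => (h.continuous_meanDefect_comp i hφ n ω).measurable)
      (tendsto_pi_nhds.2 hlim)
  refine (locallyIntegrable_const B).mono hmeas.aestronglyMeasurable (ae_of_all _ fun r => ?_)
  exact (le_of_tendsto (hlim r).abs (Eventually.of_forall fun n => hB n _)).trans (le_abs_self B)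

variable [IsProbabilityMeasure P]

lemma ae_intervalIntegral_limitDefect_eq_zero (h : IsRegularSolution T α ℱ P μ) (i : Fin d)
    (hφ : IsTest φ) {t : ℝ} (ht : t ∈ Icc 0 T) :
    ∀ᵐ ω ∂P, ∫ r in (0 : ℝ)..t, limitDefect α i φ (μ r ω) = 0 := by
  obtain ⟨B, hB0, hB⟩ := exists_abs_meanDefect_le α i hφ
  obtain ⟨C, hC0, hC⟩ := h.exists_abs_integral_mul_meanDefect_le i hφ
  let I : ℕ → Ω → ℝ := fun n ω => ∫ r in (0 : ℝ)..t, meanDefect α i φ n (μ r ω)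
  let J : Ω → ℝ := fun ω => ∫ r in (0 : ℝ)..t, limitDefect α i φ (μ r ω)
  have hIm : ∀ n, Measurable (I n) := fun n => measurable_intervalIntegral_of_continuous
    (h.continuous_meanDefect_comp i hφ n) (h.measurable_meanDefect i hφ n) 0 t
  have hIb : ∀ n ω, |I n ω ^ 2| ≤ (B * (t - 0)) ^ 2 := fun n ω => by
    rw [abs_pow]
    exact pow_le_pow_left₀ (abs_nonneg _) (abs_intervalIntegral_le ht.1 fun r _ => hB n _) 2
  have hIJ : ∀ ω, Tendsto (fun n => I n ω) atTop (𝓝 (J ω)) := fun ω =>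
    intervalIntegral.tendsto_integral_filter_of_dominated_convergence (fun _ => B)
      (Eventually.of_forall fun n =>
        (h.continuous_meanDefect_comp i hφ n ω).aestronglyMeasurable)
      (Eventually.of_forall fun n => ae_of_all _ fun r _ => hB n _)
      intervalIntegrable_const (ae_of_all _ fun r _ => tendsto_meanDefect α i hφ _)
  have hJm : Measurable J := measurable_of_tendsto_metrizable hIm (tendsto_pi_nhds.2 hIJ)
  have hlim : Tendsto (fun n => ∫ ω, I n ω ^ 2 ∂P) atTop (𝓝 (∫ ω, J ω ^ 2 ∂P)) :=
    tendsto_integral_of_dominated_convergence (fun _ => (B * (t - 0)) ^ 2)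
      (fun n => ((hIm n).pow_const 2).aestronglyMeasurable) (integrable_const _)
      (fun n => ae_of_all _ (hIb n)) (ae_of_all _ fun ω => (hIJ ω).pow 2)
  have hbound : ∀ n : ℕ, ∫ ω, I n ω ^ 2 ∂P
      ≤ 2 * (B * C * ((n : ℝ)⁻¹ * ∑ j ∈ Finset.range n, 1 / ((j : ℝ) + 1))) * t := fun n =>
    integral_sq_intervalIntegral_le (h.continuous_meanDefect_comp i hφ n)
      (h.measurable_meanDefect i hφ n) (fun r ω => hB n _) ht.1 fun s hs =>
      hC n s t hs.1 hs.2 ht.2 _ B (h.adapted_meanDefect i hφ n ⟨hs.1, hs.2.trans ht.2⟩)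
        fun ω => hB n _
  have hzero : Tendsto (fun n : ℕ =>
      2 * (B * C * ((n : ℝ)⁻¹ * ∑ j ∈ Finset.range n, 1 / ((j : ℝ) + 1))) * t) atTop (𝓝 0) := by
    have := (((tendsto_one_div_add_atTop_nhds_zero_nat (𝕜 := ℝ)).cesaro.const_mul
      (B * C)).const_mul 2).mul_const t
    simpa using this
  have hJ0 : ∫ ω, J ω ^ 2 ∂P ≤ 0 := le_of_tendsto_of_tendsto' hlim hzero hbound
  have hJb : ∀ ω, |J ω ^ 2| ≤ (B * (t - 0)) ^ 2 := fun ω =>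
    le_of_tendsto ((hIJ ω).pow 2).abs (Eventually.of_forall fun n => hIb n ω)
  have hae := (integral_eq_zero_iff_of_nonneg (fun ω => sq_nonneg (J ω))
    (integrable_of_abs_le (hJm.pow_const 2).aestronglyMeasurable hJb)).1
    (le_antisymm hJ0 (integral_nonneg fun ω => sq_nonneg _))
  filter_upwards [hae] with ω hω
  exact pow_eq_zero_iff two_ne_zero |>.1 hω

lemma ae_ae_limitDefect_eq_zero (h : IsRegularSolution T α ℱ P μ) (i : Fin d) (hφ : IsTest φ) :
    ∀ᵐ ω ∂P, ∀ᵐ r : ℝ, r ∈ Ioo 0 T → limitDefect α i φ (μ r ω) = 0 := by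
  have hq : ∀ᵐ ω ∂P, ∀ q : ℚ, (q : ℝ) ∈ Ioo 0 T →
      ∫ r in (0 : ℝ)..q, limitDefect α i φ (μ r ω) = 0 := by
    refine ae_all_iff.2 fun q => ?_
    by_cases hqT : (q : ℝ) ∈ Ioo 0 T
    · filter_upwards [h.ae_intervalIntegral_limitDefect_eq_zero i hφ (Ioo_subset_Icc_self hqT)]
        with ω hω _ using hω
    · exact ae_of_all _ fun ω hq => absurd hq hqT
  filter_upwards [hq] with ω hω
  have hloc := h.locallyIntegrable_limitDefect i hφ ω
  have hcont : Continuous fun t => ∫ r in (0 : ℝ)..t, limitDefect α i φ (μ r ω) :=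
    intervalIntegral.continuous_primitive (fun a b =>
      (hloc.integrableOn_isCompact isCompact_uIcc).intervalIntegrable) 0
  have hzero : ∀ t ∈ Ioo 0 T, ∫ r in (0 : ℝ)..t, limitDefect α i φ (μ r ω) = 0 := by
    have hsub : Ioo 0 T ∩ range ((↑) : ℚ → ℝ)
        ⊆ {t | ∫ r in (0 : ℝ)..t, limitDefect α i φ (μ r ω) = 0} := by
      rintro _ ⟨ht, q, rfl⟩
      exact hω q ht
    intro t ht
    exact closure_minimal hsub (isClosed_eq hcont continuous_const)
      (Rat.denseRange_cast.open_subset_closure_inter isOpen_Ioo ht)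
  filter_upwards [LocallyIntegrable.ae_hasDerivAt_integral hloc] with r hr hrT
  have h0 : (fun t => ∫ s in (0 : ℝ)..t, limitDefect α i φ (μ s ω)) =ᶠ[𝓝 r] fun _ => 0 := by
    filter_upwards [isOpen_Ioo.mem_nhds hrT] with t ht using hzero t ht
  exact (hr 0).unique ((hasDerivAt_const r (0 : ℝ)).congr_of_eventuallyEq h0)

/-- The initial condition of a solution charges balls with multiples of `α⁻¹`. -/
lemma mem_range_natCast_ball (h : IsRegularSolution T α ℱ P μ) (hT : 0 < T) (hα : 0 < α)
    (i : Fin d) {μ0 : ProbabilityMeasure (EuclideanSpace ℝ (Fin d))} (h0 : ∀ ω, μ 0 ω = μ0)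
    (x : EuclideanSpace ℝ (Fin d)) (r : ℝ)
    (hr : (μ0 : Measure (EuclideanSpace ℝ (Fin d))) (frontier (Metric.ball x r)) = 0) :
    α * (μ0 : Measure (EuclideanSpace ℝ (Fin d))).real (Metric.ball x r)
      ∈ range ((↑) : ℕ → ℝ) := by
  obtain ⟨ω, hω⟩ := (ae_all_iff.2 fun p =>
    h.ae_ae_limitDefect_eq_zero i (isTest_bumpFamily (d := d) p)).exists
  have hdense := Measure.dense_of_ae (ae_all_iff.2 hω)
  have hfreq : ∃ᶠ s in 𝓝[>] (0 : ℝ),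
      α * (μ s ω : Measure (EuclideanSpace ℝ (Fin d))).real (Metric.ball x r)
        ∈ range ((↑) : ℕ → ℝ) := by
    intro hev
    obtain ⟨u, hu, hsub⟩ := mem_nhdsGT_iff_exists_Ioo_subset.1 hev
    obtain ⟨s, hs, hgood⟩ := hdense.inter_open_nonempty (Ioo 0 (min u T)) isOpen_Ioo
      (nonempty_Ioo.2 (lt_min hu hT))
    exact hsub ⟨hs.1, hs.2.trans_le (min_le_left _ _)⟩ (mem_range_natCast_of_limitDefect hα i _
      (fun p => hgood p ⟨hs.1, hs.2.trans_le (min_le_right _ _)⟩) measurableSet_ball)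
  have hlim : Tendsto (fun s => μ s ω) (𝓝[>] 0) (𝓝 μ0) := by
    have := ((h.cont ω).tendsto 0).mono_left (nhdsWithin_le_nhds (s := Ioi 0))
    rwa [h0] at this
  have hlim2 := ProbabilityMeasure.tendsto_measure_of_null_frontier_of_tendsto' hlim hr
  have hlim3 := ((ENNReal.tendsto_toReal (measure_ne_top _ _)).comp hlim2).const_mul α
  exact Nat.isClosedEmbedding_coe_real.isClosed_range.mem_of_frequently_of_tendsto hfreq hlim3

end IsRegularSolution

/-- **Dean–Kawasaki: ill-posedness vs. triviality.** If the martingale problem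
`(MP)^α_{μ₀}` admits a solution, then `α` is a positive integer `n` and
`μ₀ = (1/n) ∑_{i=1}^n δ_{x_i}` for some points `x₁, …, x_n ∈ ℝ^d`. -/
theorem dean_kawasaki_nonexistence
    {d : ℕ} (hd : 1 ≤ d) {T α : ℝ} (hT : 0 < T) (hα : 0 < α)
    {Ω : Type*} [mΩ : MeasurableSpace Ω] {P : Measure Ω} [IsProbabilityMeasure P]
    {ℱ : Filtration ℝ mΩ} {μ0 : ProbabilityMeasure (EuclideanSpace ℝ (Fin d))}
    {μ : ℝ → Ω → ProbabilityMeasure (EuclideanSpace ℝ (Fin d))}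
    (hsol : IsMPSolution d T α ℱ P μ0 μ) :
    ∃ n : ℕ, 0 < n ∧ α = n ∧ ∃ x : Fin n → EuclideanSpace ℝ (Fin d),
      (μ0 : Measure (EuclideanSpace ℝ (Fin d)))
        = (n : ℝ≥0∞)⁻¹ • ∑ i : Fin n, Measure.dirac (x i) := by
  obtain ⟨ν, hν, h0⟩ := hsol.exists_isRegularSolution hT
  exact exists_sum_dirac_of_ball_mem (μ0 : Measure (EuclideanSpace ℝ (Fin d))) hα
    fun x r hr => hν.mem_range_natCast_ball hT hα ⟨0, hd⟩ h0 x r hr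

end
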